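/- arXiv:2011.06333 — 7 statements merged into one kernel-verified Lean document; each statement's English description precedes it below -/
import Mathlib

section
/- Let m₁, m₂ : [0,1] → ℝ be continuous, strictly increasing functions that are differentiable with m₁'(t) > 0 and m₂'(t) > 0 for every t ∈ [0,1]. Assume m₂(0) ≤ m₁(0) ≤ m₂(1), set d = m₂⁻¹(m₁(0)), and assume d < 1 and m₁(1 − d) ≤ m₂(1). Then the following are equivalent: (i) there exists a constant d' ∈ [0,1) such that m₁(t) = m₂(t + d') for all t ∈ (0, 1 − d'); (ii) (m₁⁻¹)'(u) = (m₂⁻¹)'(u) for every u ∈ (m₁(0), m₁(1 − d)), equivalently m₁'(m₁⁻¹(u)) = m₂'(m₂⁻¹(u)) for every such u. -/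
open Set

/-- Proposition 2.1: the null hypothesis of shift invariance holds iff the derivatives of
the inverse curves `m₁⁻¹` and `m₂⁻¹` coincide on `(m₁(0), m₁(1-d))`, where
`d = m₂⁻¹(m₁(0))`; equivalently `m₁'(m₁⁻¹(u)) = m₂'(m₂⁻¹(u))` there. -/
theorem stmt_0
    (m₁ m₂ m₁' m₂' i₁ i₂ : ℝ → ℝ)
    (hm₁c : ContinuousOn m₁ (Icc 0 1)) (hm₂c : ContinuousOn m₂ (Icc 0 1))
    (hm₁mono : StrictMonoOn m₁ (Icc 0 1)) (hm₂mono : StrictMonoOn m₂ (Icc 0 1))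
    (hm₁d : ∀ t ∈ Icc (0:ℝ) 1, HasDerivAt m₁ (m₁' t) t)
    (hm₂d : ∀ t ∈ Icc (0:ℝ) 1, HasDerivAt m₂ (m₂' t) t)
    (hm₁pos : ∀ t ∈ Icc (0:ℝ) 1, 0 < m₁' t)
    (hm₂pos : ∀ t ∈ Icc (0:ℝ) 1, 0 < m₂' t)
    (hi₁ : ∀ t ∈ Icc (0:ℝ) 1, i₁ (m₁ t) = t)
    (hi₁' : ∀ u ∈ Icc (m₁ 0) (m₁ 1), i₁ u ∈ Icc (0:ℝ) 1 ∧ m₁ (i₁ u) = u)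
    (hi₂ : ∀ t ∈ Icc (0:ℝ) 1, i₂ (m₂ t) = t)
    (hi₂' : ∀ u ∈ Icc (m₂ 0) (m₂ 1), i₂ u ∈ Icc (0:ℝ) 1 ∧ m₂ (i₂ u) = u)
    (hdom : m₂ 0 ≤ m₁ 0) (hdom' : m₁ 0 ≤ m₂ 1)
    (d : ℝ) (hd : d = i₂ (m₁ 0)) (hd1 : d < 1)
    (hrange : m₁ (1 - d) ≤ m₂ 1) :
    (∃ d' : ℝ, 0 ≤ d' ∧ d' < 1 ∧ ∀ t ∈ Ioo (0:ℝ) (1 - d'), m₁ t = m₂ (t + d')) ↔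
      (∀ u ∈ Ioo (m₁ 0) (m₁ (1 - d)), m₁' (i₁ u) = m₂' (i₂ u)) := by
  have hi0 := hi₂' (m₁ 0) ⟨hdom, hdom'⟩
  rw [← hd] at hi0
  obtain ⟨⟨hd0, -⟩, hmd⟩ := hi0
  -- uniqueness of the shift
  have key : ∀ e c : ℝ, 0 < e → c ∈ Icc (0:ℝ) 1 →
      (∀ t ∈ Ioo (0:ℝ) e, m₁ t = m₂ (t + c)) → c = d := by
    intro e c he hc h
    have h1 : Filter.Tendsto m₁ (nhdsWithin 0 (Ioi 0)) (nhds (m₁ 0)) :=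
      (hm₁d 0 (by simp)).continuousAt.tendsto.mono_left nhdsWithin_le_nhds
    have h2 : ContinuousAt (fun t => m₂ (t + c)) 0 := by
      apply ContinuousAt.comp (g := m₂) (f := fun t => t + c)
      · simpa using (hm₂d c hc).continuousAt
      · fun_prop
    have h3 : Filter.Tendsto (fun t => m₂ (t + c)) (nhdsWithin 0 (Ioi 0)) (nhds (m₂ c)) := by
      have := h2.tendsto.mono_left (nhdsWithin_le_nhds (s := Ioi (0:ℝ)))
      simpa using this
    have h4 : m₁ =ᶠ[nhdsWithin 0 (Ioi 0)] (fun t => m₂ (t + c)) := by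
      filter_upwards [Ioo_mem_nhdsGT he] with t ht using h t ht
    have h5 : m₁ 0 = m₂ c := tendsto_nhds_unique h1 (h3.congr' h4.symm)
    rw [hd, h5, hi₂ c hc]
  have m1lt : ∀ t ∈ Ioo (0:ℝ) (1 - d), m₁ t ∈ Ioo (m₁ 0) (m₁ (1 - d)) := by
    intro t ht
    exact ⟨hm₁mono (by simp) ⟨ht.1.le, by linarith [ht.2]⟩ ht.1,
      hm₁mono ⟨ht.1.le, by linarith [ht.2]⟩ ⟨by linarith, by linarith⟩ ht.2⟩
  constructor
  · rintro ⟨d', hd'0, hd'1, h⟩ u hu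
    have hdd : d' = d := key (1 - d') d' (by linarith) ⟨hd'0, hd'1.le⟩ h
    subst hdd
    have hle : m₁ (1 - d') ≤ m₁ 1 :=
      hm₁mono.monotoneOn ⟨by linarith, by linarith⟩ (by simp) (by linarith)
    obtain ⟨ht, htu⟩ := hi₁' u ⟨hu.1.le, hu.2.le.trans hle⟩
    set t := i₁ u with htdef
    have ht0 : 0 < t := by
      rw [← hm₁mono.lt_iff_lt (by simp) ht, htu]; exact hu.1
    have ht1 : t < 1 - d' := by
      rw [← hm₁mono.lt_iff_lt ht ⟨by linarith, by linarith⟩, htu]; exact hu.2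
    have hmem : t + d' ∈ Icc (0:ℝ) 1 := ⟨by linarith, by linarith⟩
    have e : i₂ u = t + d' := by
      rw [← htu, h t ⟨ht0, ht1⟩, hi₂ _ hmem]
    rw [e]
    have a1 := hm₁d t ht
    have a2 : HasDerivAt (fun x => m₂ (x + d')) (m₂' (t + d')) t :=
      (hm₂d _ hmem).comp_add_const t d'
    refine a1.unique (a2.congr_of_eventuallyEq ?_)
    filter_upwards [Ioo_mem_nhds ht0 ht1] with x hx using h x hx
  · intro h
    have hio : ∀ u ∈ Ioo (m₂ 0) (m₂ 1), i₂ u ∈ Ioo (0:ℝ) 1 := by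
      intro u hu
      obtain ⟨a, b⟩ := hi₂' u ⟨hu.1.le, hu.2.le⟩
      constructor
      · rw [← hm₂mono.lt_iff_lt (by simp) a, b]; exact hu.1
      · rw [← hm₂mono.lt_iff_lt a (by simp), b]; exact hu.2
    have himono : StrictMonoOn i₂ (Icc (m₂ 0) (m₂ 1)) := by
      intro u hu v hv huv
      obtain ⟨a, b⟩ := hi₂' u hu
      obtain ⟨a', b'⟩ := hi₂' v hv
      rw [← hm₂mono.lt_iff_lt a a', b, b']; exact huv
    have hder : ∀ u ∈ Ioo (m₂ 0) (m₂ 1), HasDerivAt i₂ (m₂' (i₂ u))⁻¹ u := by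
      intro u hu
      have hI := hio u hu
      have hIc : i₂ u ∈ Icc (0:ℝ) 1 := ⟨hI.1.le, hI.2.le⟩
      have hcont : ContinuousAt i₂ u := by
        apply himono.continuousAt_of_image_mem_nhds (Icc_mem_nhds hu.1 hu.2)
        apply Filter.mem_of_superset (Icc_mem_nhds hI.1 hI.2)
        intro t ht
        exact ⟨m₂ t, ⟨hm₂mono.monotoneOn (by simp) ht ht.1,
          hm₂mono.monotoneOn ht (by simp) ht.2⟩, hi₂ t ht⟩
      refine HasDerivAt.of_local_left_inverse hcont (hm₂d _ hIc) (hm₂pos _ hIc).ne' ?_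
      filter_upwards [Icc_mem_nhds hu.1 hu.2] with x hx using (hi₂' x hx).2
    have hin : ∀ t ∈ Ioo (0:ℝ) (1 - d), m₁ t ∈ Ioo (m₂ 0) (m₂ 1) := fun t ht =>
      ⟨hdom.trans_lt (m1lt t ht).1, (m1lt t ht).2.trans_le hrange⟩
    have hg : ∀ t ∈ Ioo (0:ℝ) (1 - d), HasDerivAt (fun t => i₂ (m₁ t) - t) 0 t := by
      intro t ht
      have htI : t ∈ Icc (0:ℝ) 1 := ⟨ht.1.le, by linarith [ht.2]⟩
      have a := ((hder _ (hin t ht)).comp t (hm₁d t htI)).sub (hasDerivAt_id t)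
      have b := h _ (m1lt t ht)
      rw [hi₁ t htI] at b
      rw [← b, inv_mul_cancel₀ (hm₁pos t htI).ne', sub_self] at a
      exact a
    have hmid : (1 - d) / 2 ∈ Ioo (0:ℝ) (1 - d) := ⟨by linarith, by linarith⟩
    obtain ⟨c, hc⟩ : ∃ c, ∀ t ∈ Ioo (0:ℝ) (1 - d), i₂ (m₁ t) - t = c := by
      refine ⟨i₂ (m₁ ((1 - d) / 2)) - (1 - d) / 2, fun t ht => ?_⟩
      refine isOpen_Ioo.is_const_of_deriv_eq_zero (f := fun t => i₂ (m₁ t) - t)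
        isPreconnected_Ioo
        (fun x hx => (hg x hx).differentiableAt.differentiableWithinAt)
        (fun x hx => (hg x hx).deriv) ht hmid
    have heq : ∀ t ∈ Ioo (0:ℝ) (1 - d), m₁ t = m₂ (t + c) := by
      intro t ht
      have e : t + c = i₂ (m₁ t) := by linarith [hc t ht]
      rw [e, (hi₂' _ ⟨(hin t ht).1.le, (hin t ht).2.le⟩).2]
    have hc0 : 0 ≤ c := by
      by_contra hneg
      push Not at hneg
      have ht : min (-c / 2) ((1 - d) / 2) ∈ Ioo (0:ℝ) (1 - d) :=
        ⟨lt_min (by linarith) (by linarith), (min_le_right _ _).trans_lt (by linarith)⟩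
      have := (hio _ (hin _ ht)).1
      linarith [hc _ ht, min_le_left (-c / 2) ((1 - d) / 2)]
    have hc1 : c ≤ 1 := by
      linarith [hc _ hmid, (hio _ (hin _ hmid)).2]
    have hcd := key (1 - d) c (by linarith) ⟨hc0, hc1⟩ heq
    subst hcd
    exact ⟨c, hc0, hd1, heq⟩
end

section
/- Let m₁, m₂ : [0,1] → ℝ be continuous, strictly increasing functions that are differentiable with m₁'(t) > 0 and m₂'(t) > 0 for every t ∈ [0,1]. Assume m₂(0) ≤ m₁(0) ≤ m₂(1), set d = m₂⁻¹(m₁(0)), and assume d < 1 and m₁(1 − d) ≤ m₂(1). If (m₁⁻¹)'(u) = (m₂⁻¹)'(u) for every u ∈ (m₁(0), m₁(1 − d)), then m₁(t) = m₂(t + d) for all t ∈ [0, 1 − d]. -/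
open Set

/-- Converse direction of Proposition 2.1: if `(m₁⁻¹)'(u) = (m₂⁻¹)'(u)` (i.e.
`1/m₁'(m₁⁻¹(u)) = 1/m₂'(m₂⁻¹(u))`) for every `u ∈ (m₁(0), m₁(1-d))` with
`d = m₂⁻¹(m₁(0))`, then `m₁(t) = m₂(t + d)` for all `t ∈ [0, 1-d]`. -/
theorem stmt_2
    (m₁ m₂ m₁' m₂' i₁ i₂ : ℝ → ℝ)
    (hm₁c : ContinuousOn m₁ (Icc 0 1)) (hm₂c : ContinuousOn m₂ (Icc 0 1))
    (hm₁mono : StrictMonoOn m₁ (Icc 0 1)) (hm₂mono : StrictMonoOn m₂ (Icc 0 1))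
    (hm₁d : ∀ t ∈ Icc (0:ℝ) 1, HasDerivAt m₁ (m₁' t) t)
    (hm₂d : ∀ t ∈ Icc (0:ℝ) 1, HasDerivAt m₂ (m₂' t) t)
    (hm₁pos : ∀ t ∈ Icc (0:ℝ) 1, 0 < m₁' t)
    (hm₂pos : ∀ t ∈ Icc (0:ℝ) 1, 0 < m₂' t)
    (hi₁ : ∀ t ∈ Icc (0:ℝ) 1, i₁ (m₁ t) = t)
    (hi₁' : ∀ u ∈ Icc (m₁ 0) (m₁ 1), i₁ u ∈ Icc (0:ℝ) 1 ∧ m₁ (i₁ u) = u)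
    (hi₂ : ∀ t ∈ Icc (0:ℝ) 1, i₂ (m₂ t) = t)
    (hi₂' : ∀ u ∈ Icc (m₂ 0) (m₂ 1), i₂ u ∈ Icc (0:ℝ) 1 ∧ m₂ (i₂ u) = u)
    (hdom : m₂ 0 ≤ m₁ 0) (hdom' : m₁ 0 ≤ m₂ 1)
    (d : ℝ) (hd : d = i₂ (m₁ 0)) (hd1 : d < 1)
    (hrange : m₁ (1 - d) ≤ m₂ 1)
    (hderiv : ∀ u ∈ Ioo (m₁ 0) (m₁ (1 - d)),
        1 / m₁' (i₁ u) = 1 / m₂' (i₂ u)) :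
    ∀ t ∈ Icc (0:ℝ) (1 - d), m₁ t = m₂ (t + d) := by
  have hdI : d ∈ Icc (0:ℝ) 1 ∧ m₂ d = m₁ 0 := by rw [hd]; exact hi₂' _ ⟨hdom, hdom'⟩
  obtain ⟨⟨hd0, -⟩, hmd⟩ := hdI
  have hi₂c : ContinuousOn i₂ (Icc (m₂ 0) (m₂ 1)) := by
    intro u hu
    obtain ⟨hiu, hiu'⟩ := hi₂' u hu
    refine tendsto_order.2 ⟨fun a ha => ?_, fun a ha => ?_⟩
    · by_cases h0 : a < 0
      · filter_upwards [self_mem_nhdsWithin] with v hv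
        exact h0.trans_le (hi₂' v hv).1.1
      · have haI : a ∈ Icc (0:ℝ) 1 := ⟨not_lt.1 h0, ha.le.trans hiu.2⟩
        have hlt : m₂ a < u := by rw [← hiu']; exact hm₂mono haI hiu ha
        filter_upwards [self_mem_nhdsWithin, mem_nhdsWithin_of_mem_nhds (Ioi_mem_nhds hlt)]
          with v hv hv'
        obtain ⟨h1, h2⟩ := hi₂' v hv
        have hv'' : m₂ a < m₂ (i₂ v) := by rw [h2]; exact hv'
        exact (hm₂mono.lt_iff_lt haI h1).1 hv''
    · by_cases h0 : 1 < a
      · filter_upwards [self_mem_nhdsWithin] with v hv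
        exact (hi₂' v hv).1.2.trans_lt h0
      · have haI : a ∈ Icc (0:ℝ) 1 := ⟨hiu.1.trans ha.le, not_lt.1 h0⟩
        have hlt : u < m₂ a := by rw [← hiu']; exact hm₂mono hiu haI ha
        filter_upwards [self_mem_nhdsWithin, mem_nhdsWithin_of_mem_nhds (Iio_mem_nhds hlt)]
          with v hv hv'
        obtain ⟨h1, h2⟩ := hi₂' v hv
        have hv'' : m₂ (i₂ v) < m₂ a := by rw [h2]; exact hv'
        exact (hm₂mono.lt_iff_lt h1 haI).1 hv''
  have hsub : ∀ t ∈ Icc (0:ℝ) (1 - d), t ∈ Icc (0:ℝ) 1 := fun t ht => ⟨ht.1, by linarith [ht.2]⟩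
  have hmaps : ∀ t ∈ Icc (0:ℝ) (1 - d), m₁ t ∈ Icc (m₂ 0) (m₂ 1) := by
    intro t ht
    have h0 := hm₁mono.monotoneOn (by simp : (0:ℝ) ∈ Icc (0:ℝ) 1) (hsub t ht) ht.1
    have h1 := hm₁mono.monotoneOn (hsub t ht) (hsub (1 - d) ⟨by linarith, le_rfl⟩) ht.2
    exact ⟨hdom.trans h0, h1.trans hrange⟩
  have key : ∀ s ∈ Ioo (0:ℝ) (1 - d), HasDerivAt (fun t => i₂ (m₁ t) - t) 0 s := by
    intro s hs
    have hsI := hsub s (Ioo_subset_Icc_self hs)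
    have h0 := hm₁mono (by simp : (0:ℝ) ∈ Icc (0:ℝ) 1) hsI hs.1
    have h1 := hm₁mono hsI (hsub (1 - d) ⟨by linarith, le_rfl⟩) hs.2
    have hnhds : Icc (m₂ 0) (m₂ 1) ∈ nhds (m₁ s) :=
      Icc_mem_nhds (hdom.trans_lt h0) (h1.trans_le hrange)
    obtain ⟨hI, -⟩ := hi₂' _ (mem_of_mem_nhds hnhds)
    have hinv : HasDerivAt i₂ (m₂' (i₂ (m₁ s)))⁻¹ (m₁ s) := by
      refine HasDerivAt.of_local_left_inverse (hi₂c.continuousAt hnhds) (hm₂d _ hI)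
        (hm₂pos _ hI).ne' ?_
      filter_upwards [hnhds] with v hv
      exact (hi₂' v hv).2
    have hE := hderiv (m₁ s) ⟨h0, h1⟩
    rw [hi₁ s hsI, one_div, one_div] at hE
    have h := (hinv.comp s (hm₁d s hsI)).sub (hasDerivAt_id s)
    rw [← hE, inv_mul_cancel₀ (hm₁pos s hsI).ne', sub_self] at h
    exact h
  have hcont : ContinuousOn (fun t => i₂ (m₁ t) - t) (Icc 0 (1 - d)) :=
    (hi₂c.comp (hm₁c.mono hsub) hmaps).sub continuousOn_id
  intro t ht
  rcases ht.1.eq_or_lt with h | h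
  · rw [← h, zero_add, hmd]
  · obtain ⟨c, -, hc⟩ := exists_hasDerivAt_eq_slope (fun t => i₂ (m₁ t) - t) (fun _ => 0) h
      (hcont.mono (Icc_subset_Icc_right ht.2))
      (fun x hx => key x ⟨hx.1, hx.2.trans_le ht.2⟩)
    rw [eq_div_iff (by linarith), ← hd] at hc
    have : i₂ (m₁ t) = t + d := by linarith
    rw [← this, (hi₂' _ (hmaps t ht)).2]
end

section
/- Let m : [0,1] → ℝ be twice continuously differentiable with m'(x) > 0 for all x ∈ [0,1], let H : ℝ → ℝ be continuously differentiable with support contained in [−1,1] and ∫_{−1}^{1} H(x) dx = 1, and let [c₁, c₂] be a compact subinterval of (m(0), m(1)). Then there exist constants C > 0 and h₀ > 0 such that for every t ∈ [c₁, c₂], every h ∈ (0, h₀] and every integer N ≥ 1, |(1/(Nh)) ∑_{i=1}^{N} H((m(i/N) − t)/h) − 1/m'(m⁻¹(t))| ≤ C (h + 1/(Nh)). -/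
open Set

lemma aux_riemann (F P : ℝ → ℝ) (N : ℕ) (hN : 1 ≤ N) (hF : ContinuousOn F (Icc 0 1))
    (hFP : ∀ x ∈ Icc (0:ℝ) 1, ∀ y ∈ Icc (0:ℝ) 1, x ≤ y → |F y - F x| ≤ P y - P x) :
    |1 / (N:ℝ) * ∑ j ∈ Finset.Icc 1 N, F ((j:ℝ) / N) - ∫ x in (0:ℝ)..1, F x|
      ≤ 1 / (N:ℝ) * (P 1 - P 0) := by
  have hN0 : (0:ℝ) < N := by exact_mod_cast hN
  have hs : ∑ j ∈ Finset.Icc 1 N, F ((j:ℝ) / N)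
      = ∑ k ∈ Finset.range N, F (((k+1 : ℕ):ℝ) / N) := by
    rw [Finset.range_eq_Ico, Finset.sum_Ico_add' (fun j : ℕ => F ((j:ℝ)/N)) 0 N 1]
    rfl
  have hmem : ∀ k : ℕ, k ≤ N → (k:ℝ) / N ∈ Icc (0:ℝ) 1 := by
    intro k hk
    refine ⟨by positivity, ?_⟩
    rw [div_le_one hN0]
    exact_mod_cast hk
  have hle : ∀ k : ℕ, (k:ℝ) / N ≤ ((k+1:ℕ):ℝ) / N := by
    intro k
    push_cast
    gcongr
    linarith
  have hsub : ∀ k : ℕ, k < N → uIcc ((k:ℝ)/N) (((k+1:ℕ):ℝ)/N) ⊆ Icc (0:ℝ) 1 := by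
    intro k hk
    rw [uIcc_of_le (hle k)]
    exact Icc_subset_Icc (hmem k hk.le).1 (hmem (k+1) hk).2
  have hII : ∀ k : ℕ, k < N →
      IntervalIntegrable F MeasureTheory.volume ((k:ℝ)/N) (((k+1:ℕ):ℝ)/N) :=
    fun k hk => (hF.mono (hsub k hk)).intervalIntegrable
  have hint := intervalIntegral.sum_integral_adjacent_intervals
    (f := F) (μ := MeasureTheory.volume) (a := fun k : ℕ => (k:ℝ)/N) (n := N) hII
  simp only [Nat.cast_zero, zero_div, div_self hN0.ne'] at hint
  rw [hs, ← hint, Finset.mul_sum, ← Finset.sum_sub_distrib]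
  have htel := Finset.sum_range_sub (fun k : ℕ => P ((k:ℝ)/N)) N
  simp only [Nat.cast_zero, zero_div, div_self hN0.ne'] at htel
  rw [← htel, Finset.mul_sum]
  refine (Finset.abs_sum_le_sum_abs _ _).trans (Finset.sum_le_sum fun k hk => ?_)
  have hk' : k < N := Finset.mem_range.1 hk
  have hlen : ((k+1:ℕ):ℝ)/N - (k:ℝ)/N = 1 / N := by
    push_cast; field_simp; ring
  have e1 : 1 / (N:ℝ) * F (((k+1:ℕ):ℝ)/N) - ∫ x in ((k:ℝ)/N)..(((k+1:ℕ):ℝ)/N), F x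
      = ∫ x in ((k:ℝ)/N)..(((k+1:ℕ):ℝ)/N), (F (((k+1:ℕ):ℝ)/N) - F x) := by
    rw [intervalIntegral.integral_sub (by simp) (hII k hk'), intervalIntegral.integral_const, hlen,
      smul_eq_mul]
  rw [e1]
  have hb := intervalIntegral.norm_integral_le_of_norm_le_const
    (a := (k:ℝ)/N) (b := ((k+1:ℕ):ℝ)/N) (f := fun x => F (((k+1:ℕ):ℝ)/N) - F x)
    (C := P (((k+1:ℕ):ℝ)/N) - P ((k:ℝ)/N)) (by
      intro x hx
      rw [uIoc_of_le (hle k)] at hx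
      have hx1 : x ∈ Icc (0:ℝ) 1 := hsub k hk' (by
        rw [uIcc_of_le (hle k)]; exact ⟨hx.1.le, hx.2⟩)
      have h1 := hFP x hx1 _ (hmem (k+1) hk') hx.2
      have h2 := hFP _ (hmem k hk'.le) x hx1 hx.1.le
      have h3 := abs_nonneg (F x - F ((k:ℝ)/N))
      rw [Real.norm_eq_abs]
      linarith)
  rw [hlen, abs_of_pos (by positivity), Real.norm_eq_abs, mul_comm] at hb
  exact hb

lemma aux_subst (m m' K : ℝ → ℝ) (t h : ℝ) (hh : 0 < h)
    (hmd : ∀ x ∈ Icc (0:ℝ) 1, HasDerivAt m (m' x) x) (hm'c : ContinuousOn m' (Icc 0 1))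
    (hK : Continuous K) (hKs : Function.support K ⊆ Ioo (-1) 1)
    (h0 : h ≤ t - m 0) (h1 : h ≤ m 1 - t) :
    ∫ x in (0:ℝ)..1, K ((m x - t) / h) * (m' x / h) = ∫ x in (-1:ℝ)..1, K x := by
  have := intervalIntegral.integral_comp_mul_deriv (a := 0) (b := 1)
    (f := fun x => (m x - t) / h) (f' := fun x => m' x / h) (g := K)
    (by
      intro x hx
      rw [uIcc_of_le zero_le_one] at hx
      exact ((hmd x hx).sub_const t).div_const h)
    (by
      rw [uIcc_of_le zero_le_one]
      exact hm'c.div_const h) hK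
  simp only [Function.comp] at this
  rw [this, intervalIntegral.integral_eq_integral_of_support_subset,
    intervalIntegral.integral_eq_integral_of_support_subset]
  · exact hKs.trans Ioo_subset_Ioc_self
  · refine hKs.trans (Ioo_subset_Ioc_self.trans (Ioc_subset_Ioc ?_ ?_))
    · rw [div_le_iff₀ hh]; linarith
    · rw [le_div_iff₀ hh]; linarith



/-- Uniform deterministic error bound for the smoothed estimator of `(m⁻¹)'`:
on a compact subinterval `[c₁, c₂] ⊂ (m(0), m(1))`, the kernel Riemann sum
`(1/(Nh)) ∑ H((m(i/N)-t)/h)` approximates `1/m'(m⁻¹(t))` with error `O(h + 1/(Nh))`. -/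
theorem stmt_8
    (m m' m'' i H H' : ℝ → ℝ) (c₁ c₂ : ℝ)
    (hmd : ∀ x ∈ Icc (0:ℝ) 1, HasDerivAt m (m' x) x)
    (hmd2 : ∀ x ∈ Icc (0:ℝ) 1, HasDerivAt m' (m'' x) x)
    (hm''c : ContinuousOn m'' (Icc 0 1))
    (hm'pos : ∀ x ∈ Icc (0:ℝ) 1, 0 < m' x)
    (hHd : ∀ y, HasDerivAt H (H' y) y) (hH'c : Continuous H')
    (hHsupp : Function.support H ⊆ Icc (-1) 1)
    (hHint : ∫ x in (-1:ℝ)..1, H x = 1)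
    (hi : ∀ x ∈ Icc (0:ℝ) 1, i (m x) = x)
    (hi' : ∀ u ∈ Icc (m 0) (m 1), i u ∈ Icc (0:ℝ) 1 ∧ m (i u) = u)
    (hc₁ : m 0 < c₁) (hc₁₂ : c₁ ≤ c₂) (hc₂ : c₂ < m 1) :
    ∃ C > (0:ℝ), ∃ h₀ > (0:ℝ), ∀ t ∈ Icc c₁ c₂, ∀ h : ℝ, 0 < h → h ≤ h₀ →
      ∀ N : ℕ, 1 ≤ N →
        |(1 / ((N : ℝ) * h)) * ∑ j ∈ Finset.Icc 1 N, H ((m ((j : ℝ) / (N : ℝ)) - t) / h)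
            - 1 / m' (i t)|
          ≤ C * (h + 1 / ((N : ℝ) * h)) := by
  have hm'c : ContinuousOn m' (Icc 0 1) := fun x hx => (hmd2 x hx).continuousAt.continuousWithinAt
  have hmc : ContinuousOn m (Icc 0 1) := fun x hx => (hmd x hx).continuousAt.continuousWithinAt
  have hHc : Continuous H := continuous_iff_continuousAt.2 fun y => (hHd y).continuousAt
  have hHs : Function.support H ⊆ Ioo (-1) 1 := by
    rw [← interior_Icc]
    exact interior_maximal hHsupp hHc.isOpen_support
  have hH0 : ∀ y, y ∉ Ioo (-1:ℝ) 1 → H y = 0 := fun y hy => by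
    by_contra hne
    exact hy (hHs hne)
  -- constants
  obtain ⟨x₀, hx₀, hmin⟩ := isCompact_Icc.exists_isMinOn (nonempty_Icc.2 zero_le_one) hm'c
  set δ := m' x₀ with hδ
  have hδ0 : 0 < δ := hm'pos x₀ hx₀
  have hδle : ∀ x ∈ Icc (0:ℝ) 1, δ ≤ m' x := fun x hx => hmin hx
  obtain ⟨M, hM⟩ := isCompact_Icc.exists_bound_of_continuousOn hm''c
  have hM0 : 0 ≤ M := (norm_nonneg _).trans (hM 0 (by simp))
  obtain ⟨L, hL⟩ := (isCompact_Icc (a := (-1:ℝ)) (b := 1)).exists_bound_of_continuousOn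
    hH'c.continuousOn
  have hL0 : 0 ≤ L := (norm_nonneg _).trans (hL 0 (by simp))
  -- Lipschitz facts
  have hm'L : ∀ x ∈ Icc (0:ℝ) 1, ∀ y ∈ Icc (0:ℝ) 1, |m' y - m' x| ≤ M * |y - x| :=
    fun x hx y hy => (convex_Icc (0:ℝ) 1).norm_image_sub_le_of_norm_hasDerivWithin_le
      (fun z hz => (hmd2 z hz).hasDerivWithinAt) hM hx hy
  have hHL : ∀ x ∈ Icc (-1:ℝ) 1, ∀ y ∈ Icc (-1:ℝ) 1, |H y - H x| ≤ L * |y - x| :=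
    fun x hx y hy => (convex_Icc (-1:ℝ) 1).norm_image_sub_le_of_norm_hasDerivWithin_le
      (fun z hz => (hHd z).hasDerivWithinAt) hL hx hy
  have hmlow : ∀ x ∈ Icc (0:ℝ) 1, ∀ y ∈ Icc (0:ℝ) 1, x ≤ y → δ * (y - x) ≤ m y - m x := by
    intro x hx y hy hxy
    refine (convex_Icc (0:ℝ) 1).mul_sub_le_image_sub_of_le_deriv hmc ?_ ?_ x hx y hy hxy
    · intro z hz
      exact (hmd z (interior_subset hz)).differentiableAt.differentiableWithinAt
    · intro z hz
      rw [(hmd z (interior_subset hz)).deriv]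
      exact hδle z (interior_subset hz)
  have hmabs : ∀ x ∈ Icc (0:ℝ) 1, ∀ y ∈ Icc (0:ℝ) 1, δ * |y - x| ≤ |m y - m x| := by
    intro x hx y hy
    rcases le_total x y with hxy | hxy
    · rw [abs_of_nonneg (sub_nonneg.2 hxy)]
      exact (hmlow x hx y hy hxy).trans (le_abs_self _)
    · rw [abs_sub_comm, abs_sub_comm (m y), abs_of_nonneg (sub_nonneg.2 hxy)]
      exact (hmlow y hy x hx hxy).trans (le_abs_self _)
  -- clamp
  set cl : ℝ → ℝ := fun y => max (-1) (min 1 y) with hcl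
  have hclmem : ∀ y, cl y ∈ Icc (-1:ℝ) 1 := fun y =>
    ⟨le_max_left _ _, max_le (by norm_num) (min_le_left _ _)⟩
  have hclH : ∀ y, H y = H (cl y) := by
    intro y
    by_cases h1 : y < -1
    · have : cl y = -1 := by simp only [hcl]; rw [min_eq_right (by linarith), max_eq_left h1.le]
      rw [this, hH0 y (fun h => by linarith [h.1]), hH0 (-1) (by simp)]
    by_cases h2 : 1 < y
    · have : cl y = 1 := by
        simp only [hcl]; rw [min_eq_left h2.le, max_eq_right (by norm_num)]
      rw [this, hH0 y (fun h => by linarith [h.2]), hH0 1 (by simp)]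
    · push Not at h1 h2
      have : cl y = y := by simp only [hcl]; rw [min_eq_right h2, max_eq_right h1]
      rw [this]
  have hclmono : Monotone cl := fun a b hab => max_le_max le_rfl (min_le_min le_rfl hab)
  have hHcl : ∀ a b, a ≤ b → |H b - H a| ≤ L * cl b - L * cl a := by
    intro a b hab
    rw [hclH a, hclH b]
    refine (hHL _ (hclmem a) _ (hclmem b)).trans ?_
    rw [abs_of_nonneg (sub_nonneg.2 (hclmono hab)), mul_sub]
  set I : ℝ := ∫ x in (-1:ℝ)..1, |H x| with hI
  have hI0 : 0 ≤ I := intervalIntegral.integral_nonneg (by norm_num) fun x _ => abs_nonneg _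
  refine ⟨2 * L + M / δ ^ 3 * I + 1, by positivity, min (c₁ - m 0) (m 1 - c₂),
    lt_min (by linarith) (by linarith), ?_⟩
  intro t ht h hh hh0 N hN
  have hN0 : (0:ℝ) < N := by exact_mod_cast hN
  have ht0 : h ≤ t - m 0 := by linarith [hh0.trans (min_le_left _ _), ht.1]
  have ht1 : h ≤ m 1 - t := by linarith [hh0.trans (min_le_right _ _), ht.2]
  obtain ⟨hs, hms⟩ := hi' t ⟨by linarith, by linarith⟩
  set s := i t
  have hms0 := hm'pos s hs
  set F : ℝ → ℝ := fun x => H ((m x - t) / h) with hF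
  have hFc : ContinuousOn F (Icc 0 1) :=
    hHc.comp_continuousOn ((hmc.sub continuousOn_const).div_const h)
  have hR := aux_riemann F (fun x => L * cl ((m x - t) / h)) N hN hFc (by
    intro x hx y hy hxy
    apply hHcl
    have : m x ≤ m y := by nlinarith [hmlow x hx y hy hxy]
    gcongr)
  have hR2 : L * cl ((m 1 - t) / h) - L * cl ((m 0 - t) / h) ≤ 2 * L := by
    nlinarith [(hclmem ((m 1 - t) / h)).2, (hclmem ((m 0 - t) / h)).1]
  have hS1 := aux_subst m m' H t h hh hmd hm'c hHc hHs ht0 ht1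
  rw [hHint] at hS1
  have hS2 := aux_subst m m' (fun x => |H x|) t h hh hmd hm'c hHc.abs
    (by intro x hx; apply hHs; simpa using hx) ht0 ht1
  rw [← hI] at hS2
  have u01 : uIcc (0:ℝ) 1 = Icc 0 1 := uIcc_of_le zero_le_one
  have hFi : IntervalIntegrable F MeasureTheory.volume 0 1 :=
    ContinuousOn.intervalIntegrable (by rw [u01]; exact hFc)
  have hFmi : IntervalIntegrable (fun x => F x * (m' x / h)) MeasureTheory.volume 0 1 :=
    ContinuousOn.intervalIntegrable (by rw [u01]; exact hFc.mul (hm'c.div_const h))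
  have hFmi2 : IntervalIntegrable (fun x => |F x| * (m' x / h)) MeasureTheory.volume 0 1 :=
    ContinuousOn.intervalIntegrable (by rw [u01]; exact hFc.abs.mul (hm'c.div_const h))
  have hB : |1 / h * (∫ x in (0:ℝ)..1, F x) - 1 / m' s| ≤ M / δ ^ 3 * I * h := by
    have e : 1 / h * (∫ x in (0:ℝ)..1, F x) - 1 / m' s
        = ∫ x in (0:ℝ)..1, (1 / h * F x - 1 / m' s * (F x * (m' x / h))) := by
      rw [intervalIntegral.integral_sub (hFi.const_mul _) (hFmi.const_mul _),
        intervalIntegral.integral_const_mul, intervalIntegral.integral_const_mul, hS1, mul_one]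
    have e2 : M / δ ^ 3 * I * h
        = ∫ x in (0:ℝ)..1, (M / δ ^ 3 * h) * (|F x| * (m' x / h)) := by
      rw [intervalIntegral.integral_const_mul, hS2]; ring
    rw [e, e2, ← Real.norm_eq_abs]
    refine intervalIntegral.norm_integral_le_of_norm_le zero_le_one ?_ (hFmi2.const_mul _)
    refine Filter.Eventually.of_forall fun x hx => ?_
    have hx' : x ∈ Icc (0:ℝ) 1 := ⟨hx.1.le, hx.2⟩
    by_cases hz : F x = 0
    · simp [hz]
    have hsup : (m x - t) / h ∈ Ioo (-1:ℝ) 1 := hHs hz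
    have hmx : |m x - m s| ≤ h := by
      rw [hms, abs_le]
      have h1 := hsup.1
      have h2 := hsup.2
      rw [lt_div_iff₀ hh] at h1
      rw [div_lt_iff₀ hh] at h2
      constructor <;> linarith
    have hxs : |x - s| ≤ h / δ := by
      rw [le_div_iff₀ hδ0, mul_comm]
      exact (hmabs s hs x hx').trans hmx
    have hd : |m' s - m' x| ≤ M * (h / δ) := by
      rw [abs_sub_comm]
      exact (hm'L s hs x hx').trans (by gcongr)
    have e3 : 1 / h * F x - 1 / m' s * (F x * (m' x / h))
        = F x / h * ((m' s - m' x) / m' s) := by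
      field_simp
    rw [e3, Real.norm_eq_abs, abs_mul, abs_div, abs_div, abs_of_pos hh, abs_of_pos hms0]
    have h4 : |m' s - m' x| / m' s ≤ M * (h / δ) / δ := by
      gcongr
      exact hδle s hs
    have h5 : (1:ℝ) ≤ m' x / δ := by
      rw [le_div_iff₀ hδ0]; linarith [hδle x hx']
    calc |F x| / h * (|m' s - m' x| / m' s) ≤ |F x| / h * (M * (h / δ) / δ) := by gcongr
      _ ≤ |F x| / h * (M * (h / δ) / δ) * (m' x / δ) := le_mul_of_one_le_right (by positivity) h5
      _ = _ := by field_simp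
  set S := ∑ j ∈ Finset.Icc 1 N, F ((j:ℝ) / N) with hS
  set J := ∫ x in (0:ℝ)..1, F x
  have hA : |1 / ((N:ℝ) * h) * S - 1 / h * J| ≤ 2 * L * (1 / ((N:ℝ) * h)) := by
    have : 1 / ((N:ℝ) * h) * S - 1 / h * J = 1 / h * (1 / (N:ℝ) * S - J) := by field_simp
    rw [this, abs_mul, abs_of_pos (by positivity : 0 < 1 / h)]
    calc 1 / h * |1 / (N:ℝ) * S - J| ≤ 1 / h * (1 / (N:ℝ) * (2 * L)) := by
          refine mul_le_mul_of_nonneg_left (hR.trans ?_) (by positivity)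
          exact mul_le_mul_of_nonneg_left hR2 (by positivity)
      _ = _ := by field_simp
  have hfin := abs_sub_le (1 / ((N:ℝ) * h) * S) (1 / h * J) (1 / m' s)
  refine hfin.trans ((add_le_add hA hB).trans ?_)
  have p1 : 0 ≤ 1 / ((N:ℝ) * h) := by positivity
  have p2 : 0 ≤ M / δ ^ 3 * I := by positivity
  nlinarith [mul_nonneg hL0 hh.le, mul_nonneg p2 p1]
end

section
/- Let ψ : ℝ → ℝ be continuously differentiable with support contained in [−1,1], let G : ℝ → ℝ be continuous with compact support contained in the open interval (0,1), and let (b_n)_{n≥1} be a sequence of positive reals with b_n → 0 and n·b_n → ∞ as n → ∞. Then lim_{n→∞} (1/(n b_n)) ∑_{j=1}^{n} ∫_ℝ G(s) ψ((j/n − s)/b_n)² ds = (∫_{−1}^{1} ψ(x)² dx) · (∫_ℝ G(s) ds). -/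
open Set Filter Topology MeasureTheory

lemma riemann_aux (G : ℝ → ℝ) (hGc : Continuous G) (hU : UniformContinuous G)
    (c : ℕ → ℝ) (hc : Tendsto c atTop (𝓝 0)) :
    Tendsto (fun n : ℕ => (1 / (n : ℝ)) * ∑ j ∈ Finset.Icc 1 n, G ((j : ℝ) / n - c n)) atTop
      (𝓝 (∫ t in (0:ℝ)..1, G t)) := by
  rw [Metric.tendsto_atTop]
  intro ε hε
  obtain ⟨δ, hδ, hG⟩ := Metric.uniformContinuous_iff.1 hU (ε / 2) (by positivity)
  have h1 : ∀ᶠ n : ℕ in atTop, |c n| < δ / 2 := by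
    have := hc.abs
    rw [abs_zero] at this
    exact this.eventually_lt_const (by positivity)
  have h2 : ∀ᶠ n : ℕ in atTop, 1 / (n : ℝ) < δ / 2 :=
    tendsto_one_div_atTop_nhds_zero_nat.eventually_lt_const (by positivity)
  obtain ⟨N, hN⟩ := eventually_atTop.1 (h1.and (h2.and (eventually_gt_atTop 0)))
  refine ⟨N, fun n hn => ?_⟩
  obtain ⟨hc1, hn1, hn0⟩ := hN n hn
  have hnR : (0 : ℝ) < n := by exact_mod_cast hn0
  have hsplit : ∫ t in (0:ℝ)..1, G t
      = ∑ k ∈ Finset.range n, ∫ t in ((k : ℝ) / n)..(((k + 1 : ℕ) : ℝ) / n), G t := by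
    have := intervalIntegral.sum_integral_adjacent_intervals (f := G) (μ := volume)
      (a := fun k : ℕ => (k : ℝ) / n) (n := n)
      (fun k _ => hGc.intervalIntegrable _ _)
    rw [this]
    simp [hnR.ne']
  have hsum : ∑ j ∈ Finset.Icc 1 n, G ((j : ℝ) / n - c n)
      = ∑ k ∈ Finset.range n, G (((k + 1 : ℕ) : ℝ) / n - c n) := by
    rw [Finset.range_eq_Ico, Finset.sum_Ico_add' (fun j : ℕ => G ((j : ℝ) / n - c n)) 0 n 1]
    rfl
  have hw : ∀ k : ℕ, ((k + 1 : ℕ) : ℝ) / n - (k : ℝ) / n = 1 / n := by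
    intro k
    push_cast
    ring
  rw [hsum, hsplit, Real.dist_eq, Finset.mul_sum, ← Finset.sum_sub_distrib]
  have hterm : ∀ k ∈ Finset.range n, |1 / (n : ℝ) * G (((k + 1 : ℕ) : ℝ) / n - c n)
      - ∫ t in ((k : ℝ) / n)..(((k + 1 : ℕ) : ℝ) / n), G t| ≤ ε / 2 * (1 / n) := by
    intro k _
    have e : 1 / (n : ℝ) * G (((k + 1 : ℕ) : ℝ) / n - c n)
      - ∫ t in ((k : ℝ) / n)..(((k + 1 : ℕ) : ℝ) / n), G t
      = ∫ t in ((k : ℝ) / n)..(((k + 1 : ℕ) : ℝ) / n),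
          (G (((k + 1 : ℕ) : ℝ) / n - c n) - G t) := by
      rw [intervalIntegral.integral_sub (by simp) (hGc.intervalIntegrable _ _),
        intervalIntegral.integral_const, hw, smul_eq_mul]
    have hpos : (0 : ℝ) < 1 / n := by positivity
    rw [e, ← Real.norm_eq_abs]
    refine (intervalIntegral.norm_integral_le_of_norm_le_const (C := ε / 2) ?_).trans ?_
    · intro t ht
      rw [uIoc_of_le (by linarith [hw k])] at ht
      rw [← dist_eq_norm]
      refine (hG ?_).le
      rw [Real.dist_eq, abs_lt]
      have := abs_lt.1 hc1
      constructor <;> linarith [hw k, ht.1, ht.2]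
    · rw [hw, abs_of_pos hpos]
  calc _ ≤ _ := Finset.abs_sum_le_sum_abs _ _
    _ ≤ _ := Finset.sum_le_sum hterm
    _ = ε / 2 := by
      rw [Finset.sum_const, Finset.card_range, nsmul_eq_mul]
      field_simp
    _ < ε := by linarith

lemma cov_aux (G φ : ℝ → ℝ) (a b : ℝ) (hb : 0 < b) :
    ∫ s : ℝ, G s * φ ((a - s) / b) = b * ∫ x : ℝ, G (a - b * x) * φ x := by
  have h1 : ∀ s, G s * φ ((a - s) / b)
      = (fun y => (fun x => G (a - b * x) * φ x) (y / b)) (a - s) := by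
    intro s
    have : a - b * ((a - s) / b) = s := by field_simp; ring
    simp only [this]
  simp_rw [h1]
  rw [integral_sub_left_eq_self (fun y => (fun x => G (a - b * x) * φ x) (y / b)) volume a,
    Measure.integral_comp_div (fun x => G (a - b * x) * φ x) b, abs_of_pos hb, smul_eq_mul]

/-- Deterministic kernel-sum limit underlying the bias computation E(A₁ₐ) in (B.24):
`(1/(n bₙ)) ∑_{j=1}^{n} ∫ G(s) ψ((j/n - s)/bₙ)² ds → (∫ψ²)(∫G)`. -/
theorem stmt_12
    (ψ ψ' G : ℝ → ℝ)
    (hψd : ∀ y, HasDerivAt ψ (ψ' y) y) (hψ'c : Continuous ψ')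
    (hψsupp : Function.support ψ ⊆ Icc (-1) 1)
    (hGc : Continuous G) (hGcs : HasCompactSupport G)
    (hGsupp : tsupport G ⊆ Ioo 0 1)
    (b : ℕ → ℝ) (hb : ∀ n, 0 < b n)
    (hb0 : Tendsto b atTop (𝓝 0))
    (hnb : Tendsto (fun n : ℕ => (n : ℝ) * b n) atTop atTop) :
    Tendsto
      (fun n : ℕ => (1 / ((n : ℝ) * b n)) *
        ∑ j ∈ Finset.Icc 1 n,
          ∫ s : ℝ, G s * (ψ (((j : ℝ) / (n : ℝ) - s) / b n)) ^ 2)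
      atTop
      (𝓝 ((∫ x in (-1:ℝ)..1, (ψ x) ^ 2) * ∫ s : ℝ, G s)) := by
  have hψc : Continuous ψ := continuous_iff_continuousAt.2 fun y => (hψd y).continuousAt
  set φ : ℝ → ℝ := fun x => ψ x ^ 2 with hφ
  have hφc : Continuous φ := hψc.pow 2
  have hψ0 : ∀ x, x ∉ Icc (-1 : ℝ) 1 → ψ x = 0 := fun x hx => by
    by_contra h
    exact hx (hψsupp h)
  have hφcs : HasCompactSupport φ :=
    HasCompactSupport.intro (isCompact_Icc (a := (-1 : ℝ)) (b := 1))
      fun x hx => by simp [hφ, hψ0 x hx]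
  have hφi : Integrable φ := hφc.integrable_of_hasCompactSupport hφcs
  have hU : UniformContinuous G := hGcs.uniformContinuous_of_continuous hGc
  obtain ⟨C, hC⟩ := hGcs.exists_bound_of_continuous hGc
  have hC0 : 0 ≤ C := (norm_nonneg _).trans (hC 0)
  have hIφ : ∫ x in (-1:ℝ)..1, (ψ x) ^ 2 = ∫ x, φ x := by
    rw [intervalIntegral.integral_of_le (by norm_num), ← integral_Icc_eq_integral_Ioc]
    exact setIntegral_eq_integral_of_forall_compl_eq_zero
      fun x hx => by simp [hφ, hψ0 x hx]
  have hIG : ∫ s, G s = ∫ s in (0:ℝ)..1, G s :=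
    (intervalIntegral.integral_eq_integral_of_support_subset
      ((subset_tsupport G).trans (hGsupp.trans Ioo_subset_Ioc_self))).symm
  have hint : ∀ (n j : ℕ), Integrable (fun x => G ((j : ℝ) / n - b n * x) * φ x) := by
    intro n j
    refine Continuous.integrable_of_hasCompactSupport (by fun_prop) hφcs.mul_left
  have key : ∀ᶠ n : ℕ in atTop,
      (∫ x, ((1 / (n : ℝ)) * ∑ j ∈ Finset.Icc 1 n, G ((j : ℝ) / n - b n * x)) * φ x)
      = (1 / ((n : ℝ) * b n)) *
        ∑ j ∈ Finset.Icc 1 n, ∫ s : ℝ, G s * (ψ (((j : ℝ) / (n : ℝ) - s) / b n)) ^ 2 := by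
    filter_upwards [eventually_gt_atTop 0] with n hn
    have hnR : (0 : ℝ) < n := by exact_mod_cast hn
    have hbn := hb n
    have : ∀ j : ℕ, ∫ s : ℝ, G s * (ψ (((j : ℝ) / (n : ℝ) - s) / b n)) ^ 2
        = b n * ∫ x : ℝ, G ((j : ℝ) / n - b n * x) * φ x :=
      fun j => cov_aux G φ _ _ hbn
    simp_rw [this]
    rw [← Finset.mul_sum, ← integral_finsetSum _ (fun j _ => hint n j)]
    simp_rw [mul_assoc, Finset.sum_mul]
    rw [integral_const_mul]
    field_simp
  refine Tendsto.congr' key ?_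
  rw [hIφ, hIG, mul_comm, ← integral_const_mul]
  refine tendsto_integral_of_dominated_convergence (fun x => C * φ x) ?_ (hφi.const_mul C) ?_ ?_
  · intro n
    exact Continuous.aestronglyMeasurable (by fun_prop)
  · intro n
    refine ae_of_all _ fun x => ?_
    have hφ0 : 0 ≤ φ x := sq_nonneg _
    rw [norm_mul, Real.norm_of_nonneg hφ0]
    refine mul_le_mul_of_nonneg_right ?_ hφ0
    rcases Nat.eq_zero_or_pos n with rfl | hn
    · simpa using hC0
    have hnR : (0 : ℝ) < n := by exact_mod_cast hn
    rw [norm_mul, Real.norm_of_nonneg (by positivity : (0:ℝ) ≤ 1 / n)]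
    have : ‖∑ j ∈ Finset.Icc 1 n, G ((j : ℝ) / n - b n * x)‖ ≤ n * C := by
      refine (norm_sum_le_of_le _ (fun j _ => hC _)).trans ?_
      simp
    calc _ ≤ 1 / (n : ℝ) * (n * C) := by gcongr
      _ = C := by field_simp
  · refine ae_of_all _ fun x => ?_
    refine Tendsto.mul_const _ (riemann_aux G hGc hU (fun n => b n * x) ?_)
    simpa using hb0.mul_const x
end

section
/- Let ψ : ℝ → ℝ be continuously differentiable with support contained in [−1,1], let G : ℝ → ℝ be continuous with compact support contained in the open interval (0,1), and let (b_n)_{n≥1} be a sequence of positive reals with b_n → 0 and n·b_n → ∞ as n → ∞. Then lim_{n→∞} (1/(n² b_n³)) ∑_{j₁=1}^{n} ∑_{j₂=1}^{n} [∫_ℝ G(s) ψ((j₁/n − s)/b_n) ψ((j₂/n − s)/b_n) ds]² = (∫_ℝ (∫_ℝ ψ(x) ψ(x + y) dx)² dy) · (∫_ℝ G(s)² ds). -/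
open Set Filter Topology MeasureTheory

lemma step_aux (a : ℕ → ℝ) (n : ℕ) (hn : 0 < n) :
    ∫ u in Ioc (0:ℝ) 1, a ⌈(n:ℝ) * u⌉₊ = (1 / (n:ℝ)) * ∑ j ∈ Finset.Icc 1 n, a j := by
  have hn' : (n:ℝ) ≠ 0 := by positivity
  rw [← intervalIntegral.integral_of_le zero_le_one,
    intervalIntegral.integral_comp_mul_left (fun t => a ⌈t⌉₊) hn']
  have hcongr : ∀ k : ℕ, EqOn (fun _ : ℝ => a (k+1)) (fun t : ℝ => a ⌈t⌉₊)
      (Set.uIoc (k:ℝ) ((k+1 : ℕ):ℝ)) := by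
    intro k t ht
    rw [Set.uIoc_of_le (by push_cast; linarith)] at ht
    have : ⌈t⌉₊ = k + 1 := by
      rw [Nat.ceil_eq_iff (by omega)]
      simpa using ht
    simp [this]
  have h := intervalIntegral.sum_integral_adjacent_intervals (μ := volume)
    (f := fun t : ℝ => a ⌈t⌉₊) (a := fun k : ℕ => (k:ℝ)) (n := n) (by
      intro k _
      exact (intervalIntegrable_const (c := a (k+1))).congr (hcongr k))
  have h2 : ∀ k : ℕ, ∫ t in (k:ℝ)..((k+1 : ℕ):ℝ), a ⌈t⌉₊ = a (k+1) := by
    intro k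
    rw [← intervalIntegral.integral_congr_ae (Eventually.of_forall fun t ht => hcongr k ht)]
    simp
  simp only [h2] at h
  have h3 : ∑ j ∈ Finset.Icc 1 n, a j = ∑ k ∈ Finset.range n, a (k+1) := by
    rw [Finset.range_eq_Ico, Finset.sum_Ico_add' a 0 n 1]
    rfl
  rw [h3, h]
  simp

lemma subst_aux (G ψ : ℝ → ℝ) (p q b : ℝ) (hb : 0 < b) :
    ∫ s : ℝ, G s * ψ ((p - s) / b) * ψ ((q - s) / b)
      = b * ∫ x : ℝ, G (p - b * x) * ψ x * ψ (x + (q - p) / b) := by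
  have h1 := integral_sub_left_eq_self
    (fun s : ℝ => G s * ψ ((p - s) / b) * ψ ((q - s) / b)) volume p
  have h2 := Measure.integral_comp_mul_left
    (fun t : ℝ => G (p - t) * ψ ((p - (p - t)) / b) * ψ ((q - (p - t)) / b)) b
  rw [← h1]
  have h3 : ∀ x : ℝ, G (p - b * x) * ψ ((p - (p - b * x)) / b) * ψ ((q - (p - b * x)) / b)
      = G (p - b * x) * ψ x * ψ (x + (q - p) / b) := by
    intro x
    congr 2
    · congr 1
      field_simp
      ring
    · field_simp
      ring
  simp only [h3] at h2
  rw [h2, abs_of_pos (inv_pos.mpr hb), smul_eq_mul, ← mul_assoc, mul_inv_cancel₀ hb.ne', one_mul]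

lemma shift_aux (F : ℝ → ℝ) (u b : ℝ) (hb : 0 < b) :
    ∫ v in Ioc (0:ℝ) 1, F v = b * ∫ y : ℝ, (Ioc (0:ℝ) 1).indicator F (u + b * y) := by
  rw [← integral_indicator measurableSet_Ioc]
  have h2 := Measure.integral_comp_mul_left
    (fun t : ℝ => (Ioc (0:ℝ) 1).indicator F (u + t)) b
  rw [h2, integral_add_left_eq_self (fun t => (Ioc (0:ℝ) 1).indicator F t) u,
    abs_of_pos (inv_pos.mpr hb), smul_eq_mul, ← mul_assoc, mul_inv_cancel₀ hb.ne', one_mul]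

lemma ceil_diff (n u w : ℝ) (hu : 0 ≤ n * u) (hw : 0 ≤ n * w) :
    |((⌈n * w⌉₊ : ℝ) - ⌈n * u⌉₊) - n * (w - u)| ≤ 1 := by
  have a1 := Nat.le_ceil (n * u)
  have a2 := Nat.ceil_lt_add_one hu
  have a3 := Nat.le_ceil (n * w)
  have a4 := Nat.ceil_lt_add_one hw
  rw [abs_le]
  constructor <;> linarith

lemma q_diff (n u y b : ℝ) (hn : 0 < n) (hb : 0 < b) (hu : 0 ≤ u) (hw : 0 ≤ u + b * y) :
    |((⌈n * (u + b * y)⌉₊ : ℝ) / n - ⌈n * u⌉₊ / n) / b - y| ≤ 1 / (n * b) := by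
  have h := ceil_diff n u (u + b * y) (by positivity) (by positivity)
  have e : ((⌈n * (u + b * y)⌉₊ : ℝ) / n - ⌈n * u⌉₊ / n) / b - y
      = (((⌈n * (u + b * y)⌉₊ : ℝ) - ⌈n * u⌉₊) - n * (u + b * y - u)) / (n * b) := by
    field_simp
    ring
  rw [e, abs_div, abs_of_pos (mul_pos hn hb)]
  gcongr

theorem stmt_13
    (ψ ψ' G : ℝ → ℝ)
    (hψd : ∀ y, HasDerivAt ψ (ψ' y) y) (hψ'c : Continuous ψ')
    (hψsupp : Function.support ψ ⊆ Icc (-1) 1)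
    (hGc : Continuous G) (hGcs : HasCompactSupport G)
    (hGsupp : tsupport G ⊆ Ioo 0 1)
    (b : ℕ → ℝ) (hb : ∀ n, 0 < b n)
    (hb0 : Tendsto b atTop (𝓝 0))
    (hnb : Tendsto (fun n : ℕ => (n : ℝ) * b n) atTop atTop) :
    Tendsto
      (fun n : ℕ => (1 / ((n : ℝ) ^ 2 * (b n) ^ 3)) *
        ∑ j₁ ∈ Finset.Icc 1 n, ∑ j₂ ∈ Finset.Icc 1 n,
          (∫ s : ℝ, G s * ψ (((j₁ : ℝ) / (n : ℝ) - s) / b n)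
              * ψ (((j₂ : ℝ) / (n : ℝ) - s) / b n)) ^ 2)
      atTop
      (𝓝 ((∫ y : ℝ, (∫ x : ℝ, ψ x * ψ (x + y)) ^ 2) * ∫ s : ℝ, (G s) ^ 2)) := by
  have hψc : Continuous ψ := continuous_iff_continuousAt.2 fun y => (hψd y).continuousAt
  have hψcs : HasCompactSupport ψ := HasCompactSupport.intro isCompact_Icc (K := Icc (-1) 1)
    fun x hx => by
      by_contra h
      exact hx (hψsupp h)
  have hψ0 : ∀ x, ψ x ≠ 0 → |x| ≤ 1 := fun x hx => abs_le.2 (hψsupp hx)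
  obtain ⟨Mψ, hMψ⟩ := hψcs.exists_bound_of_continuous hψc
  obtain ⟨MG, hMG⟩ := hGcs.exists_bound_of_continuous hGc
  have hMψ0 : 0 ≤ Mψ := (norm_nonneg _).trans (hMψ 0)
  have hMG0 : 0 ≤ MG := (norm_nonneg _).trans (hMG 0)
  have hψi : Integrable ψ := hψc.integrable_of_hasCompactSupport hψcs
  set D : ℝ → ℝ := fun x => MG * ‖ψ x‖ * Mψ with hD
  have hDi : Integrable D := (hψi.norm.const_mul MG).mul_const Mψ
  set C : ℝ := ∫ x, D x with hC
  have hC0 : 0 ≤ C := integral_nonneg fun x => by positivity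
  have hdom : ∀ p c q x : ℝ, ‖G (p - c * x) * ψ x * ψ (x + q)‖ ≤ D x := by
    intro p c q x
    rw [norm_mul, norm_mul]
    have := hMG (p - c * x)
    have := hMψ (x + q)
    simp only [hD]
    gcongr
  set B : ℝ → ℝ → ℝ → ℝ := fun c p q => ∫ x, G (p - c * x) * ψ x * ψ (x + q) with hB
  have hBbd : ∀ c p q, |B c p q| ≤ C := fun c p q =>
    norm_integral_le_of_norm_le hDi (Eventually.of_forall (hdom p c q))
  have hB0 : ∀ c p q, 2 < |q| → B c p q = 0 := by
    intro c p q hq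
    simp only [hB]
    apply integral_eq_zero_of_ae
    refine Eventually.of_forall fun x => ?_
    by_contra hne
    simp only [Pi.zero_apply, mul_eq_zero, not_or] at hne
    have h1 := abs_le.1 (hψ0 _ hne.1.2)
    have h2 := abs_le.1 (hψ0 _ hne.2)
    rcases lt_abs.1 hq with h | h <;> linarith [h1.1, h1.2, h2.1, h2.2]
  have hBlim : ∀ (p q : ℕ → ℝ) (u y : ℝ), Tendsto p atTop (𝓝 u) → Tendsto q atTop (𝓝 y) →
      Tendsto (fun n => B (b n) (p n) (q n)) atTop (𝓝 (G u * ∫ x, ψ x * ψ (x + y))) := by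
    intro p q u y hp hq
    rw [← integral_const_mul]
    refine tendsto_integral_of_dominated_convergence D ?_ hDi ?_ ?_
    · intro n
      exact Continuous.aestronglyMeasurable (by fun_prop)
    · intro n
      exact Eventually.of_forall (hdom _ _ _)
    · refine Eventually.of_forall fun x => ?_
      have h1 : Tendsto (fun n => p n - b n * x) atTop (𝓝 u) := by
        simpa using hp.sub (hb0.mul_const x)
      have h2 : Tendsto (fun n => x + q n) atTop (𝓝 (x + y)) := hq.const_add x
      have h3 := (((hGc.tendsto u).comp h1).mul_const (ψ x)).mul ((hψc.tendsto _).comp h2)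
      simpa [Function.comp_def, mul_assoc] using h3
  -- the discrete kernel
  set A : ℕ → ℕ → ℕ → ℝ := fun n j k =>
    (B (b n) ((j:ℝ) / n) (((k:ℝ) / n - (j:ℝ) / n) / b n)) ^ 2 with hA
  set g : ℕ → ℕ → ℝ := fun n j => (1 / (n * b n)) * ∑ k ∈ Finset.Icc 1 n, A n j k with hg
  have hgint : ∀ n : ℕ, 0 < n → ∀ j u, g n j = ∫ y : ℝ,
      (Ioc (0:ℝ) 1).indicator (fun v => A n j ⌈(n:ℝ) * v⌉₊) (u + b n * y) := by
    intro n hn j u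
    have h1 := step_aux (fun k => A n j k) n hn
    rw [shift_aux _ u (b n) (hb n)] at h1
    have hbn := (hb n).ne'
    have hn' : (n:ℝ) ≠ 0 := by positivity
    simp only [hg]
    rw [← mul_right_inj' hbn, h1]
    field_simp
  have hexp : ∀ n : ℕ, 0 < n → (1 / ((n : ℝ) ^ 2 * (b n) ^ 3)) *
        ∑ j₁ ∈ Finset.Icc 1 n, ∑ j₂ ∈ Finset.Icc 1 n,
          (∫ s : ℝ, G s * ψ (((j₁ : ℝ) / (n : ℝ) - s) / b n)
              * ψ (((j₂ : ℝ) / (n : ℝ) - s) / b n)) ^ 2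
      = ∫ u in Ioc (0:ℝ) 1, g n ⌈(n:ℝ) * u⌉₊ := by
    intro n hn
    rw [step_aux (g n) n hn]
    have hbn := (hb n).ne'
    have hn' : (n:ℝ) ≠ 0 := by positivity
    simp only [subst_aux G ψ _ _ (b n) (hb n), hg, mul_pow, ← Finset.mul_sum, hA, hB]
    field_simp
  have hpt : ∀ n : ℕ, 0 < n → 1 ≤ (n:ℝ) * b n → ∀ u : ℝ, 0 ≤ u → ∀ y : ℝ,
      ‖(Ioc (0:ℝ) 1).indicator (fun v => A n ⌈(n:ℝ) * u⌉₊ ⌈(n:ℝ) * v⌉₊) (u + b n * y)‖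
        ≤ (Icc (-3:ℝ) 3).indicator (fun _ => C ^ 2) y := by
    intro n hn hn1 u hu y
    have hn' : (0:ℝ) < n := by positivity
    by_cases hv : u + b n * y ∈ Ioc (0:ℝ) 1
    · rw [indicator_of_mem hv]
      have hq := q_diff n u y (b n) hn' (hb n) hu hv.1.le
      have hle : 1 / ((n:ℝ) * b n) ≤ 1 := by
        rw [div_le_one (by linarith)]; exact hn1
      by_cases hy : y ∈ Icc (-3:ℝ) 3
      · rw [indicator_of_mem hy]
        simp only [hA, norm_pow, Real.norm_eq_abs]
        exact pow_le_pow_left₀ (abs_nonneg _) (hBbd _ _ _) 2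
      · rw [indicator_of_notMem hy]
        have h3 : 3 < |y| := by
          by_contra h
          exact hy (abs_le.1 (not_lt.1 h))
        simp only [hA]
        rw [hB0]
        · simp
        · have := abs_sub_abs_le_abs_sub y
            (((⌈(n:ℝ) * (u + b n * y)⌉₊ : ℝ) / n - ⌈(n:ℝ) * u⌉₊ / n) / b n)
          rw [abs_sub_comm] at this
          linarith
    · rw [indicator_of_notMem hv]
      simp only [norm_zero]
      exact indicator_nonneg (fun _ _ => by positivity) y
  have hdi : Integrable ((Icc (-3:ℝ) 3).indicator (fun _ => C ^ 2)) :=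
    (integrable_indicator_iff measurableSet_Icc).2
      (integrableOn_const (by simp))
  have hev : ∀ᶠ n : ℕ in atTop, 0 < n ∧ 1 ≤ (n:ℝ) * b n :=
    (eventually_gt_atTop 0).and (hnb.eventually_ge_atTop 1)
  set Q : ℝ := ∫ y : ℝ, (∫ x : ℝ, ψ x * ψ (x + y)) ^ 2 with hQ
  -- pointwise limit of the inner sums
  have hinner : ∀ u ∈ Ioo (0:ℝ) 1,
      Tendsto (fun n : ℕ => g n ⌈(n:ℝ) * u⌉₊) atTop (𝓝 (Q * G u ^ 2)) := by
    intro u hu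
    have h1 : Tendsto (fun n : ℕ => ∫ y : ℝ,
        (Ioc (0:ℝ) 1).indicator (fun v => A n ⌈(n:ℝ) * u⌉₊ ⌈(n:ℝ) * v⌉₊) (u + b n * y)) atTop
        (𝓝 (∫ y : ℝ, (G u * ∫ x, ψ x * ψ (x + y)) ^ 2)) := by
      refine tendsto_integral_filter_of_dominated_convergence _ ?_ ?_ hdi ?_
      · refine Eventually.of_forall fun n => ?_
        have hm : Measurable (fun v : ℝ => A n ⌈(n:ℝ) * u⌉₊ ⌈(n:ℝ) * v⌉₊) :=
          (measurable_from_top (f := A n ⌈(n:ℝ) * u⌉₊)).comp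
            (Nat.measurable_ceil.comp (measurable_const_mul (n:ℝ)))
        exact ((hm.indicator measurableSet_Ioc).comp
          ((measurable_const_mul (b n)).const_add u)).aestronglyMeasurable
      · filter_upwards [hev] with n hn
        exact Eventually.of_forall (hpt n hn.1 hn.2 u hu.1.le)
      · refine Eventually.of_forall fun y => ?_
        have hw : Tendsto (fun n => u + b n * y) atTop (𝓝 u) := by
          simpa using (hb0.mul_const y).const_add u
        have hwev : ∀ᶠ n in atTop, u + b n * y ∈ Ioo (0:ℝ) 1 :=
          hw.eventually (isOpen_Ioo.mem_nhds hu)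
        have hp : Tendsto (fun n : ℕ => (⌈(n:ℝ) * u⌉₊ : ℝ) / n) atTop (𝓝 u) := by
          have := (tendsto_nat_ceil_mul_div_atTop (R := ℝ) hu.1.le).comp
            tendsto_natCast_atTop_atTop (α := ℕ)
          simpa [Function.comp_def, mul_comm] using this
        have hq : Tendsto (fun n : ℕ =>
            ((⌈(n:ℝ) * (u + b n * y)⌉₊ : ℝ) / n - ⌈(n:ℝ) * u⌉₊ / n) / b n) atTop (𝓝 y) := by
          rw [tendsto_iff_norm_sub_tendsto_zero]
          refine squeeze_zero' (Eventually.of_forall fun _ => norm_nonneg _) ?_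
            (hnb.const_div_atTop 1)
          filter_upwards [hwev, hev] with n hn hn1
          exact q_diff n u y (b n) (by exact_mod_cast hn1.1) (hb n) hu.1.le hn.1.le
        refine ((hBlim _ _ u y hp hq).pow 2).congr' ?_
        filter_upwards [hwev] with n hn
        rw [indicator_of_mem (Ioo_subset_Ioc_self hn)]
    have h2 : ∫ y : ℝ, (G u * ∫ x, ψ x * ψ (x + y)) ^ 2 = Q * G u ^ 2 := by
      simp only [mul_pow]
      rw [integral_const_mul, mul_comm]
    rw [h2] at h1
    refine h1.congr' ?_
    filter_upwards [hev] with n hn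
    exact (hgint n hn.1 _ u).symm
  have hfin : Q * ∫ s, G s ^ 2 = ∫ u in Ioc (0:ℝ) 1, Q * G u ^ 2 := by
    rw [integral_const_mul, setIntegral_eq_integral_of_forall_compl_eq_zero]
    intro x hx
    have : G x = 0 := image_eq_zero_of_notMem_tsupport
      fun h => hx (Ioo_subset_Ioc_self (hGsupp h))
    simp [this]
  rw [hfin]
  have hmain : Tendsto (fun n : ℕ => ∫ u in Ioc (0:ℝ) 1, g n ⌈(n:ℝ) * u⌉₊) atTop
      (𝓝 (∫ u in Ioc (0:ℝ) 1, Q * G u ^ 2)) := by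
    refine tendsto_integral_filter_of_dominated_convergence
      (fun _ => ∫ y, (Icc (-3:ℝ) 3).indicator (fun _ => C ^ 2) y) ?_ ?_ ?_ ?_
    · refine Eventually.of_forall fun n => ?_
      exact ((measurable_from_top (f := g n)).comp
            (Nat.measurable_ceil.comp (measurable_const_mul (n:ℝ)))).aestronglyMeasurable
    · filter_upwards [hev] with n hn
      filter_upwards [ae_restrict_mem measurableSet_Ioc] with u hu
      rw [hgint n hn.1 _ u]
      exact norm_integral_le_of_norm_le hdi
        (Eventually.of_forall (hpt n hn.1 hn.2 u hu.1.le))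
    · exact integrableOn_const (by simp)
    · rw [← Measure.restrict_congr_set (Ioo_ae_eq_Ioc (a := (0:ℝ)) (b := 1) (μ := volume))]
      filter_upwards [ae_restrict_mem measurableSet_Ioo] with u hu
      exact hinner u hu
  refine hmain.congr' ?_
  filter_upwards [hev] with n hn
  exact (hexp n hn.1).symm
end

section
/- Let ψ, χ : ℝ → ℝ be continuously differentiable with support contained in [−1,1], let G : ℝ → ℝ be continuous with compact support S contained in the open interval (0,1), and let θ : [0,1] → ℝ be continuously differentiable with θ(S) ⊂ (0,1). Let (b_n) and (c_n) be sequences of positive reals with c_n → 0, n·c_n → ∞, and b_n/c_n → γ for some γ ∈ (0,∞). Then lim_{n→∞} (1/(n² b_n² c_n)) ∑_{j₁=1}^{n} ∑_{j₂=1}^{n} [∫_ℝ G(s) ψ((j₁/n − s)/b_n) χ((j₂/n − θ(s))/c_n) ds]² = ∫₀¹ ∫_ℝ G(u)² [∫_ℝ ψ(x) χ(y + γ·θ'(u)·x) dx]² dy du. -/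
open Set Filter Topology MeasureTheory

lemma step_int (n : ℕ) (hn : 0 < n) (f : ℕ → ℝ) :
    ∫ u in Ioc (0:ℝ) 1, f ⌈(n:ℝ) * u⌉₊ = (1 / (n:ℝ)) * ∑ j ∈ Finset.Icc 1 n, f j := by
  have hn' : (0:ℝ) < n := by exact_mod_cast hn
  have key : ∀ k : ℕ, EqOn (fun u : ℝ => f ⌈(n:ℝ) * u⌉₊) (fun _ => f (k+1))
      (uIoc ((k:ℝ)/n) (((k+1:ℕ):ℝ)/n)) := by
    intro k u hu
    rw [uIoc_of_le (by gcongr; simp)] at hu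
    have h1 : (k:ℝ) < n * u := by
      have := hu.1; rw [div_lt_iff₀ hn'] at this; linarith
    have h2 : n * u ≤ ((k+1:ℕ):ℝ) := by
      have := hu.2; rw [le_div_iff₀ hn'] at this; linarith
    have : ⌈(n:ℝ) * u⌉₊ = k + 1 := by
      rw [Nat.ceil_eq_iff (by simp)]
      exact ⟨by simpa using h1, h2⟩
    simp only [this]
  have hsum := intervalIntegral.sum_integral_adjacent_intervals (μ := volume)
    (f := fun u : ℝ => f ⌈(n:ℝ) * u⌉₊)
    (a := fun k : ℕ => (k:ℝ)/n) (n := n) (by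
      intro k _
      exact (intervalIntegrable_const (c := f (k+1))).congr (key k).symm)
  simp only [Nat.cast_zero, zero_div, div_self hn'.ne'] at hsum
  rw [← intervalIntegral.integral_of_le zero_le_one, ← hsum]
  have : ∀ k ∈ Finset.range n, ∫ u in ((k:ℝ)/n)..(((k+1:ℕ):ℝ)/n), f ⌈(n:ℝ) * u⌉₊
      = (1/(n:ℝ)) * f (k+1) := by
    intro k _
    rw [intervalIntegral.integral_congr_ae (g := fun _ => f (k+1))
      (Eventually.of_forall fun u hu => key k hu)]
    rw [intervalIntegral.integral_const, smul_eq_mul]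
    push_cast; field_simp; ring
  rw [Finset.sum_congr rfl this, ← Finset.mul_sum]
  congr 1
  rw [Finset.range_eq_Ico, Finset.sum_Ico_add' f 0 n 1]
  rfl

lemma cov (F : ℝ → ℝ) (v b : ℝ) (hb : 0 < b) :
    ∫ s, F s = b * ∫ x, F (v - b * x) := by
  rw [Measure.integral_comp_mul_left (fun t => F (v - t)) b,
    integral_sub_left_eq_self F volume v, abs_of_pos (inv_pos.2 hb), smul_eq_mul]
  field_simp

lemma cov2 (F : ℝ → ℝ) (v c : ℝ) (hc : 0 < c) :
    (1 / c) * ∫ s, F s = ∫ x, F (v + c * x) := by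
  rw [Measure.integral_comp_mul_left (fun t => F (v + t)) c,
    integral_add_left_eq_self F v, abs_of_pos (inv_pos.2 hc), smul_eq_mul, one_div]

/-- Rescaled inner integral. -/
noncomputable def KK (ψ χ G θ : ℝ → ℝ) (b c v w : ℝ) : ℝ :=
  ∫ x, G (v - b * x) * ψ x * χ ((w - θ (v - b * x)) / c)

lemma ceil_div_abs (n : ℕ) (hn : 0 < n) (u : ℝ) (hu : 0 ≤ u) :
    |(⌈(n:ℝ) * u⌉₊ : ℝ) / n - u| ≤ 1 / n := by
  have hn' : (0:ℝ) < n := by exact_mod_cast hn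
  have h1 := Nat.le_ceil ((n:ℝ) * u)
  have h2 := Nat.ceil_lt_add_one (mul_nonneg hn'.le hu)
  have : (⌈(n:ℝ) * u⌉₊ : ℝ) / n - u = (⌈(n:ℝ) * u⌉₊ - n * u) / n := by field_simp
  rw [this, abs_of_nonneg (div_nonneg (by linarith) hn'.le)]
  gcongr; linarith

lemma KK_bound (ψ χ G θ : ℝ → ℝ) (MG Mχ : ℝ) (hψi : Integrable ψ)
    (hMG : ∀ x, |G x| ≤ MG) (hMχ : ∀ x, |χ x| ≤ Mχ) (b c v w : ℝ) :
    |KK ψ χ G θ b c v w| ≤ MG * Mχ * ∫ x, |ψ x| := by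
  have hM0 : 0 ≤ MG := (abs_nonneg _).trans (hMG 0)
  rw [← integral_const_mul, ← Real.norm_eq_abs]
  refine norm_integral_le_of_norm_le (hψi.abs.const_mul _) (Eventually.of_forall fun x => ?_)
  rw [Real.norm_eq_abs, abs_mul, abs_mul]
  calc |G (v - b * x)| * |ψ x| * |χ ((w - θ (v - b * x)) / c)|
      ≤ MG * |ψ x| * Mχ := by
        gcongr
        · exact hMG _
        · exact hMχ _
    _ = _ := by ring

/-- inner pointwise limit -/
lemma KK_lim (ψ χ G θ : ℝ → ℝ) (γ MG Mχ : ℝ)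
    (hψi : Integrable ψ) (hψc : Continuous ψ) (hχc : Continuous χ) (hGc : Continuous G)
    (hθc : Continuous θ)
    (hMG : ∀ x, |G x| ≤ MG) (hMχ : ∀ x, |χ x| ≤ Mχ)
    (b c : ℕ → ℝ) (hc : ∀ n, 0 < c n)
    (hc0 : Tendsto c atTop (𝓝 0))
    (hnc : Tendsto (fun n : ℕ => (n : ℝ) * c n) atTop atTop)
    (hbc : Tendsto (fun n : ℕ => b n / c n) atTop (𝓝 γ))
    (u y d : ℝ) (hu : 0 ≤ u) (hθu : G u ≠ 0 → HasDerivAt θ d u ∧ 0 < θ u) :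
    Tendsto (fun n : ℕ => KK ψ χ G θ (b n) (c n) ((⌈(n:ℝ) * u⌉₊ : ℝ) / n)
        ((⌈(n:ℝ) * (θ u + c n * y)⌉₊ : ℝ) / n)) atTop
      (𝓝 (∫ x, G u * ψ x * χ (y + γ * d * x))) := by
  have hM0 : 0 ≤ MG := (abs_nonneg _).trans (hMG 0)
  have hb0 : Tendsto b atTop (𝓝 0) := by
    have := hbc.mul hc0
    rw [mul_zero] at this
    exact this.congr fun n => by have := (hc n).ne'; field_simp
  have h1n : Tendsto (fun n : ℕ => 1 / (n:ℝ)) atTop (𝓝 0) := tendsto_one_div_atTop_nhds_zero_nat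
  have h1nc : Tendsto (fun n : ℕ => 1 / ((n:ℝ) * c n)) atTop (𝓝 0) :=
    tendsto_const_nhds.div_atTop hnc
  have hv : Tendsto (fun n : ℕ => (⌈(n:ℝ) * u⌉₊ : ℝ) / n - u) atTop (𝓝 0) := by
    refine squeeze_zero_norm' ?_ h1n
    filter_upwards [eventually_gt_atTop 0] with n hn
    exact ceil_div_abs n hn u hu
  have hvc : Tendsto (fun n : ℕ => ((⌈(n:ℝ) * u⌉₊ : ℝ) / n - u) / c n) atTop (𝓝 0) := by
    refine squeeze_zero_norm' ?_ h1nc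
    filter_upwards [eventually_gt_atTop 0] with n hn
    rw [Real.norm_eq_abs, abs_div, abs_of_pos (hc n), ← div_div]
    exact div_le_div_of_nonneg_right (ceil_div_abs n hn u hu) (hc n).le
  have hGlim : ∀ x : ℝ, Tendsto (fun n : ℕ => G ((⌈(n:ℝ) * u⌉₊ : ℝ) / n - b n * x)) atTop
      (𝓝 (G u)) := by
    intro x
    refine (hGc.tendsto u).comp ?_
    have := (hv.sub (hb0.mul_const x)).add_const u
    simp only [zero_mul, sub_zero, zero_add] at this
    exact this.congr fun n => by ring
  refine tendsto_integral_of_dominated_convergence (fun x => MG * Mχ * |ψ x|) ?_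
    (hψi.abs.const_mul _) ?_ ?_
  · intro n
    apply Continuous.aestronglyMeasurable
    fun_prop
  · intro n
    refine Eventually.of_forall fun x => ?_
    rw [Real.norm_eq_abs, abs_mul, abs_mul]
    calc _ ≤ MG * |ψ x| * Mχ := by
          gcongr
          · exact hMG _
          · exact hMχ _
      _ = _ := by ring
  · refine Eventually.of_forall fun x => ?_
    by_cases hG : G u = 0
    · have h0 := hGlim x
      rw [hG] at h0 ⊢
      simp only [zero_mul]
      have h2 := (h0.abs.mul_const (|ψ x| * Mχ))
      rw [abs_zero, zero_mul] at h2
      refine squeeze_zero_norm (fun n => ?_) h2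
      rw [Real.norm_eq_abs, abs_mul, abs_mul, mul_assoc]
      gcongr
      exact hMχ _
    · obtain ⟨hd, hpos⟩ := hθu hG
      refine ((hGlim x).mul_const _).mul ((hχc.tendsto _).comp ?_)
      -- the derivative part
      have hδ : Tendsto (fun n : ℕ => (⌈(n:ℝ) * u⌉₊ : ℝ) / n - u - b n * x) atTop (𝓝 0) := by
        simpa using hv.sub (hb0.mul_const x)
      have hcδ : Tendsto (fun n : ℕ => (c n)⁻¹ • ((⌈(n:ℝ) * u⌉₊ : ℝ) / n - u - b n * x)) atTop
          (𝓝 (-(γ * x))) := by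
        have := hvc.sub (hbc.mul_const x)
        rw [zero_sub] at this
        refine this.congr fun n => ?_
        rw [smul_eq_mul]; have := (hc n).ne'; field_simp
      have hD := (hasFDerivWithinAt_univ.2 hd.hasFDerivAt).lim hδ
        (Eventually.of_forall fun _ => mem_univ _) hcδ
      have hw : Tendsto (fun n : ℕ => ((⌈(n:ℝ) * (θ u + c n * y)⌉₊ : ℝ) / n - (θ u + c n * y)) / c n)
          atTop (𝓝 0) := by
        refine squeeze_zero_norm' ?_ h1nc
        have hp : Tendsto (fun n => θ u + c n * y) atTop (𝓝 (θ u)) := by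
          simpa using (hc0.mul_const y).const_add (θ u)
        filter_upwards [eventually_gt_atTop 0, hp.eventually (lt_mem_nhds hpos)] with n hn hn2
        rw [Real.norm_eq_abs, abs_div, abs_of_pos (hc n), ← div_div]
        exact div_le_div_of_nonneg_right (ceil_div_abs n hn _ hn2.le) (hc n).le
      have := (hw.add_const y).sub hD
      have e : (0 : ℝ) + y - (ContinuousLinearMap.toSpanSingleton ℝ d) (-(γ * x)) = y + γ * d * x := by
        simp; ring
      rw [e] at this
      refine this.congr fun n => ?_
      have hcn := (hc n).ne'
      have e2 : u + ((⌈(n:ℝ) * u⌉₊ : ℝ) / n - u - b n * x) = (⌈(n:ℝ) * u⌉₊ : ℝ) / n - b n * x := by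
        ring
      rw [e2, smul_eq_mul]
      field_simp
      ring

lemma KK_zero (ψ χ G θ : ℝ → ℝ) (L : NNReal) (hL : LipschitzWith L θ) (γ : ℝ)
    (hψs : ∀ x, 1 < |x| → ψ x = 0) (hχs : ∀ x, 1 < |x| → χ x = 0)
    (b c : ℝ) (hb : 0 < b) (hc : 0 < c) (n : ℕ) (hn : 0 < n)
    (h1 : 1 / (n * c) ≤ 1) (h2 : b / c ≤ γ + 1)
    (u y : ℝ) (hu : 0 ≤ u) (hy : 0 ≤ θ u + c * y) (hyR : 2 + L * (γ + 2) < |y|) :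
    KK ψ χ G θ b c ((⌈(n:ℝ) * u⌉₊ : ℝ) / n) ((⌈(n:ℝ) * (θ u + c * y)⌉₊ : ℝ) / n) = 0 := by
  unfold KK
  rw [← integral_zero ℝ ℝ (μ := volume)]
  congr 1
  ext x
  by_cases hx : 1 < |x|
  · simp [hψs x hx]
  push Not at hx
  rw [hχs, mul_zero]
  set v := (⌈(n:ℝ) * u⌉₊ : ℝ) / n with hv
  set w := (⌈(n:ℝ) * (θ u + c * y)⌉₊ : ℝ) / n with hw
  have a1 : |v - u| ≤ 1 / n := ceil_div_abs n hn u hu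
  have a2 : |w - (θ u + c * y)| ≤ 1 / n := ceil_div_abs n hn _ hy
  have hn' : (0:ℝ) < n := by exact_mod_cast hn
  have h1' : 1 / (n:ℝ) ≤ c := by
    rw [← div_div, div_le_one hc] at h1; exact h1
  have h2' : b ≤ (γ + 1) * c := by rwa [div_le_iff₀ hc] at h2
  have a3 : |θ (v - b * x) - θ u| ≤ L * |v - b * x - u| := by
    have := hL.dist_le_mul (v - b * x) u
    rwa [Real.dist_eq, Real.dist_eq] at this
  have a4 : |v - b * x - u| ≤ c + (γ + 1) * c := by
    calc |v - b * x - u| = |(v - u) - b * x| := by ring_nf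
      _ ≤ |v - u| + |b * x| := abs_sub _ _
      _ ≤ c + (γ + 1) * c := by
        rw [abs_mul, abs_of_pos hb]
        have : b * |x| ≤ b := by nlinarith [abs_nonneg x]
        linarith
  have a5 : |θ (v - b * x) - θ u| ≤ L * (c + (γ + 1) * c) :=
    a3.trans (mul_le_mul_of_nonneg_left a4 L.2)
  rw [abs_div, abs_of_pos hc, lt_div_iff₀ hc]
  have a6 : c * |y| ≤ |w - θ (v - b * x)| + |w - (θ u + c * y)| + |θ (v - b * x) - θ u| := by
    have : c * y = (w - θ (v - b * x)) - (w - (θ u + c * y)) + (θ (v - b * x) - θ u) := by ring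
    calc c * |y| = |c * y| := by rw [abs_mul, abs_of_pos hc]
      _ = |(w - θ (v - b * x)) - (w - (θ u + c * y)) + (θ (v - b * x) - θ u)| :=
        congrArg _ this
      _ ≤ _ := (abs_add_le _ _).trans (by gcongr; exact abs_sub _ _)
  have a7 : c * (2 + L * (γ + 2)) < c * |y| := by gcongr
  nlinarith

theorem core
    (ψ χ G θ θ' : ℝ → ℝ) (γ : ℝ) (MG Mχ : ℝ) (L : NNReal) (hγ : 0 < γ)
    (hψi : Integrable ψ) (hψc : Continuous ψ) (hχc : Continuous χ) (hGc : Continuous G)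
    (hL : LipschitzWith L θ)
    (hMG : ∀ x, |G x| ≤ MG) (hMχ : ∀ x, |χ x| ≤ Mχ)
    (hψs : ∀ x, 1 < |x| → ψ x = 0) (hχs : ∀ x, 1 < |x| → χ x = 0)
    (hθ : ∀ u, G u ≠ 0 → HasDerivAt θ (θ' u) u ∧ θ u ∈ Ioo (0:ℝ) 1)
    (b c : ℕ → ℝ) (hb : ∀ n, 0 < b n) (hc : ∀ n, 0 < c n)
    (hc0 : Tendsto c atTop (𝓝 0))
    (hnc : Tendsto (fun n : ℕ => (n : ℝ) * c n) atTop atTop)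
    (hbc : Tendsto (fun n : ℕ => b n / c n) atTop (𝓝 γ)) :
    Tendsto
      (fun n : ℕ => (1 / ((n : ℝ) ^ 2 * (b n) ^ 2 * c n)) *
        ∑ j₁ ∈ Finset.Icc 1 n, ∑ j₂ ∈ Finset.Icc 1 n,
          (∫ s : ℝ, G s * ψ (((j₁ : ℝ) / (n : ℝ) - s) / b n)
              * χ (((j₂ : ℝ) / (n : ℝ) - θ s) / c n)) ^ 2)
      atTop
      (𝓝 (∫ u in (0:ℝ)..1, ∫ y : ℝ,
        (G u) ^ 2 * (∫ x : ℝ, ψ x * χ (y + γ * θ' u * x)) ^ 2)) := by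
  set C : ℝ := MG * Mχ * ∫ x, |ψ x| with hC
  set R : ℝ := 2 + L * (γ + 2) with hR
  have hR0 : 0 ≤ R := by positivity
  set K : ℕ → ℕ → ℕ → ℝ := fun n j₁ j₂ =>
    KK ψ χ G θ (b n) (c n) ((j₁:ℝ) / n) ((j₂:ℝ) / n) with hK
  set H : ℕ → ℕ → ℝ := fun n j₁ => (1 / c n) * ((1 / (n:ℝ)) *
    ∑ j₂ ∈ Finset.Icc 1 n, K n j₁ j₂ ^ 2) with hH
  set Φ : ℕ → ℝ → ℝ → ℝ := fun n u y => (Ioc (0:ℝ) 1).indicator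
    (fun w => K n ⌈(n:ℝ) * u⌉₊ ⌈(n:ℝ) * w⌉₊ ^ 2) (θ u + c n * y) with hΦ
  have hKb : ∀ n i j, K n i j ^ 2 ≤ C ^ 2 := by
    intro n i j
    have := KK_bound ψ χ G θ MG Mχ hψi hMG hMχ (b n) (c n) ((i:ℝ)/n) ((j:ℝ)/n)
    rw [← sq_abs]
    exact pow_le_pow_left₀ (abs_nonneg _) this 2
  have hHΦ : ∀ n : ℕ, 0 < n → ∀ u : ℝ, H n ⌈(n:ℝ) * u⌉₊ = ∫ y, Φ n u y := by
    intro n hn u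
    simp only [hH, hΦ]
    rw [← step_int n hn (fun j => K n ⌈(n:ℝ) * u⌉₊ j ^ 2), ← integral_indicator measurableSet_Ioc,
      cov2 _ (θ u) (c n) (hc n)]
  have hI : ∀ n : ℕ, ∀ j₁ j₂ : ℕ, (∫ s : ℝ, G s * ψ (((j₁ : ℝ) / (n : ℝ) - s) / b n)
              * χ (((j₂ : ℝ) / (n : ℝ) - θ s) / c n)) = b n * K n j₁ j₂ := by
    intro n j₁ j₂
    rw [cov _ ((j₁:ℝ)/n) (b n) (hb n)]
    simp only [hK, KK]
    congr 2
    ext x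
    have : ((j₁:ℝ)/n - ((j₁:ℝ)/n - b n * x)) / b n = x := by
      have := (hb n).ne'; field_simp; ring
    rw [this]
  have hS : ∀ n : ℕ, 0 < n → ∫ u in (0:ℝ)..1, H n ⌈(n:ℝ) * u⌉₊ =
      (1 / ((n : ℝ) ^ 2 * (b n) ^ 2 * c n)) *
        ∑ j₁ ∈ Finset.Icc 1 n, ∑ j₂ ∈ Finset.Icc 1 n,
          (∫ s : ℝ, G s * ψ (((j₁ : ℝ) / (n : ℝ) - s) / b n)
              * χ (((j₂ : ℝ) / (n : ℝ) - θ s) / c n)) ^ 2 := by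
    intro n hn
    rw [intervalIntegral.integral_of_le zero_le_one, step_int n hn]
    simp only [hI, hH, mul_pow, ← Finset.mul_sum]
    have h1 := (hb n).ne'
    have h2 := (hc n).ne'
    have h3 : (n:ℝ) ≠ 0 := by exact_mod_cast hn.ne'
    field_simp
  have hev : ∀ᶠ n : ℕ in atTop, 0 < n ∧ 1 / ((n:ℝ) * c n) ≤ 1 ∧ b n / c n ≤ γ + 1 := by
    have h1nc : Tendsto (fun n : ℕ => 1 / ((n:ℝ) * c n)) atTop (𝓝 0) :=
      tendsto_const_nhds.div_atTop hnc
    filter_upwards [eventually_gt_atTop 0, h1nc.eventually (ge_mem_nhds zero_lt_one),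
      hbc.eventually (ge_mem_nhds (lt_add_one γ))] with n h1 h2 h3
    exact ⟨h1, h2, h3⟩
  have hΦb : ∀ᶠ n : ℕ in atTop, ∀ u, 0 ≤ u → ∀ y, ‖Φ n u y‖ ≤
      (Icc (-R) R).indicator (fun _ => C ^ 2) y := by
    filter_upwards [hev] with n ⟨h1, h2, h3⟩ u hu y
    simp only [hΦ]
    by_cases hw : θ u + c n * y ∈ Ioc (0:ℝ) 1
    · rw [indicator_of_mem hw]
      by_cases hy : y ∈ Icc (-R) R
      · rw [indicator_of_mem hy, Real.norm_eq_abs, abs_of_nonneg (sq_nonneg _)]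
        exact hKb _ _ _
      · rw [indicator_of_notMem hy]
        have hy' : R < |y| := by
          by_contra hcon
          exact hy (abs_le.1 (not_lt.1 hcon))
        have := KK_zero ψ χ G θ L hL γ hψs hχs (b n) (c n) (hb n) (hc n) n h1 h2 h3 u y hu
          hw.1.le hy'
        simp only [hK]
        rw [this]; simp
    · rw [indicator_of_notMem hw, norm_zero]
      exact indicator_nonneg (fun _ _ => sq_nonneg _) _
  have hbi : Integrable ((Icc (-R) R).indicator (fun _ : ℝ => C ^ 2)) := by
    rw [integrable_indicator_iff measurableSet_Icc]
    exact integrableOn_const (by simp)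
  have hΦm : ∀ n u, AEStronglyMeasurable (Φ n u) := by
    intro n u
    apply Measurable.aestronglyMeasurable
    have : Measurable ((Ioc (0:ℝ) 1).indicator
      (fun w => K n ⌈(n:ℝ) * u⌉₊ ⌈(n:ℝ) * w⌉₊ ^ 2)) := by
      refine Measurable.indicator ?_ measurableSet_Ioc
      exact (measurable_from_top (f := fun j : ℕ => K n ⌈(n:ℝ) * u⌉₊ j ^ 2)).comp
        (Nat.measurable_ceil.comp (measurable_const_mul _))
    exact this.comp (by fun_prop)
  have hΦlim : ∀ u, 0 ≤ u → ∀ y, Tendsto (fun n => Φ n u y) atTop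
      (𝓝 ((G u) ^ 2 * (∫ x : ℝ, ψ x * χ (y + γ * θ' u * x)) ^ 2)) := by
    intro u hu y
    have h := KK_lim ψ χ G θ γ MG Mχ hψi hψc hχc hGc hL.continuous hMG hMχ b c hc hc0 hnc hbc
      u y (θ' u) hu (fun h => ⟨(hθ u h).1, (hθ u h).2.1⟩)
    have h2 := h.pow 2
    simp only [mul_assoc (G u)] at h2
    rw [integral_const_mul, mul_pow] at h2
    by_cases hG : G u = 0
    · simp only [hG, ne_eq, OfNat.ofNat_ne_zero, not_false_eq_true, zero_pow, zero_mul] at h2 ⊢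
      refine squeeze_zero (fun n => ?_) (fun n => ?_) h2
      · exact indicator_nonneg (fun _ _ => sq_nonneg _) _
      · exact indicator_le_self' (f := fun w => K n ⌈(n:ℝ) * u⌉₊ ⌈(n:ℝ) * w⌉₊ ^ 2)
          (fun _ _ => sq_nonneg _) _
    · refine h2.congr' ?_
      have hp : Tendsto (fun n => θ u + c n * y) atTop (𝓝 (θ u)) := by
        simpa using (hc0.mul_const y).const_add (θ u)
      filter_upwards [hp.eventually (Ioo_mem_nhds (hθ u hG).2.1 (hθ u hG).2.2)] with n hn
      simp only [hΦ]
      rw [indicator_of_mem (Ioo_subset_Ioc_self hn)]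
  have main : Tendsto (fun n : ℕ => ∫ u in (0:ℝ)..1, H n ⌈(n:ℝ) * u⌉₊) atTop
      (𝓝 (∫ u in (0:ℝ)..1, ∫ y : ℝ,
        (G u) ^ 2 * (∫ x : ℝ, ψ x * χ (y + γ * θ' u * x)) ^ 2)) := by
    refine intervalIntegral.tendsto_integral_filter_of_dominated_convergence
      (fun _ => ∫ y, (Icc (-R) R).indicator (fun _ : ℝ => C ^ 2) y) ?_ ?_ (by simp) ?_
    · refine Eventually.of_forall fun n => Measurable.aestronglyMeasurable ?_
      exact (measurable_from_top (f := fun j : ℕ => H n j)).comp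
        (Nat.measurable_ceil.comp (measurable_const_mul _))
    · filter_upwards [hΦb, eventually_gt_atTop 0] with n hn hn0
      refine Eventually.of_forall fun u hu => ?_
      rw [uIoc_of_le zero_le_one] at hu
      rw [hHΦ n hn0 u]
      exact norm_integral_le_of_norm_le hbi (Eventually.of_forall (hn u hu.1.le))
    · refine Eventually.of_forall fun u hu => ?_
      rw [uIoc_of_le zero_le_one] at hu
      have : Tendsto (fun n => ∫ y, Φ n u y) atTop (𝓝 (∫ y : ℝ,
        (G u) ^ 2 * (∫ x : ℝ, ψ x * χ (y + γ * θ' u * x)) ^ 2)) := by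
        refine tendsto_integral_filter_of_dominated_convergence
          ((Icc (-R) R).indicator (fun _ : ℝ => C ^ 2)) (Eventually.of_forall fun n => hΦm n u)
          ?_ hbi (Eventually.of_forall (hΦlim u hu.1.le))
        filter_upwards [hΦb] with n hn
        exact Eventually.of_forall (hn u hu.1.le)
      refine this.congr' ?_
      filter_upwards [eventually_gt_atTop 0] with n hn
      exact (hHΦ n hn u).symm
  refine main.congr' ?_
  filter_upwards [eventually_gt_atTop 0] with n hn
  exact hS n hn

/-- Deterministic two-bandwidth, two-kernel double-sum limit underlying the
cross-covariance computation Var(A₁₂) in (B.34):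
`(1/(n² bₙ² cₙ)) ∑_{j₁,j₂} [∫ G(s) ψ((j₁/n - s)/bₙ) χ((j₂/n - θ(s))/cₙ) ds]²
→ ∫₀¹ ∫ G(u)² [∫ ψ(x) χ(y + γ θ'(u) x) dx]² dy du`. -/
theorem stmt_14
    (ψ ψ' χ χ' G θ θ' : ℝ → ℝ) (γ : ℝ) (hγ : 0 < γ)
    (hψd : ∀ y, HasDerivAt ψ (ψ' y) y) (hψ'c : Continuous ψ')
    (hψsupp : Function.support ψ ⊆ Icc (-1) 1)
    (hχd : ∀ y, HasDerivAt χ (χ' y) y) (hχ'c : Continuous χ')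
    (hχsupp : Function.support χ ⊆ Icc (-1) 1)
    (hGc : Continuous G) (hGcs : HasCompactSupport G)
    (hGsupp : tsupport G ⊆ Ioo 0 1)
    (hθd : ∀ x ∈ Icc (0:ℝ) 1, HasDerivAt θ (θ' x) x)
    (hθ'c : ContinuousOn θ' (Icc 0 1))
    (hθmap : ∀ s ∈ tsupport G, θ s ∈ Ioo (0:ℝ) 1)
    (b c : ℕ → ℝ) (hb : ∀ n, 0 < b n) (hc : ∀ n, 0 < c n)
    (hc0 : Tendsto c atTop (𝓝 0))
    (hnc : Tendsto (fun n : ℕ => (n : ℝ) * c n) atTop atTop)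
    (hbc : Tendsto (fun n : ℕ => b n / c n) atTop (𝓝 γ)) :
    Tendsto
      (fun n : ℕ => (1 / ((n : ℝ) ^ 2 * (b n) ^ 2 * c n)) *
        ∑ j₁ ∈ Finset.Icc 1 n, ∑ j₂ ∈ Finset.Icc 1 n,
          (∫ s : ℝ, G s * ψ (((j₁ : ℝ) / (n : ℝ) - s) / b n)
              * χ (((j₂ : ℝ) / (n : ℝ) - θ s) / c n)) ^ 2)
      atTop
      (𝓝 (∫ u in (0:ℝ)..1, ∫ y : ℝ,
        (G u) ^ 2 * (∫ x : ℝ, ψ x * χ (y + γ * θ' u * x)) ^ 2)) := by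
  have hψc : Continuous ψ := continuous_iff_continuousAt.2 fun y => (hψd y).continuousAt
  have hχc : Continuous χ := continuous_iff_continuousAt.2 fun y => (hχd y).continuousAt
  have out : ∀ f : ℝ → ℝ, Function.support f ⊆ Icc (-1) 1 → ∀ x, 1 < |x| → f x = 0 := by
    intro f hf x hx
    by_contra h
    exact absurd (abs_le.2 (hf h)) (not_le.2 hx)
  have hψcs : HasCompactSupport ψ := HasCompactSupport.of_support_subset_isCompact isCompact_Icc hψsupp
  have hχcs : HasCompactSupport χ := HasCompactSupport.of_support_subset_isCompact isCompact_Icc hχsupp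
  obtain ⟨MG, hMG⟩ := hGcs.exists_bound_of_continuous hGc
  obtain ⟨Mχ, hMχ⟩ := hχcs.exists_bound_of_continuous hχc
  obtain ⟨L, hL⟩ := isCompact_Icc.exists_bound_of_continuousOn hθ'c
  have hLip : LipschitzOnWith (Real.toNNReal L) θ (Icc 0 1) := by
    refine (convex_Icc (0:ℝ) 1).lipschitzOnWith_of_nnnorm_hasDerivWithin_le
      (fun x hx => (hθd x hx).hasDerivWithinAt) (fun x hx => ?_)
    rw [← NNReal.coe_le_coe]
    exact (hL x hx).trans (Real.le_coe_toNNReal L)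
  set ϑ : ℝ → ℝ := IccExtend (zero_le_one (α := ℝ)) ((Icc (0:ℝ) 1).domRestrict θ) with hϑ
  have hϑL : LipschitzWith (Real.toNNReal L) ϑ := by
    have := hLip.to_restrict.comp (LipschitzWith.projIcc (zero_le_one (α := ℝ)))
    rw [mul_one] at this
    exact this
  have hϑe : ∀ s ∈ Icc (0:ℝ) 1, ϑ s = θ s := by
    intro s hs
    rw [hϑ, IccExtend_of_mem _ _ hs, domRestrict_apply]
  have hGt : ∀ s, G s ≠ 0 → s ∈ Ioo (0:ℝ) 1 := fun s hs => hGsupp (subset_tsupport G hs)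
  have key := core ψ χ G ϑ θ' γ MG Mχ (Real.toNNReal L) hγ
    (hψc.integrable_of_hasCompactSupport hψcs) hψc hχc hGc hϑL hMG hMχ (out ψ hψsupp) (out χ hχsupp)
    (fun u hu => ⟨(hθd u (Ioo_subset_Icc_self (hGt u hu))).congr_of_eventuallyEq
        (by filter_upwards [Ioo_mem_nhds (hGt u hu).1 (hGt u hu).2] with s hs
            exact hϑe s (Ioo_subset_Icc_self hs)),
      by rw [hϑe u (Ioo_subset_Icc_self (hGt u hu))]; exact hθmap u (subset_tsupport G hu)⟩)
    b c hb hc hc0 hnc hbc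
  refine key.congr fun n => ?_
  congr 1
  refine Finset.sum_congr rfl fun j₁ _ => Finset.sum_congr rfl fun j₂ _ => ?_
  congr 2
  ext s
  by_cases hs : G s = 0
  · simp [hs]
  · rw [hϑe s (Ioo_subset_Icc_self (hGt s hs))]
end

section
/- Let m : [0,1] → ℝ be twice continuously differentiable with m'(x) > 0 for all x ∈ [0,1], let M : [0,1] → ℝ be continuously differentiable, let H : ℝ → ℝ be continuously differentiable with support contained in [−1,1], and let K̄ : ℝ → ℝ be continuously differentiable with support contained in [−1,1]. Fix t ∈ (m(0), m(1)), and let (b_n), (h_n) be sequences of positive reals with b_n → 0, h_n → 0, n·b_n → ∞ and h_n/b_n → 0. Define Q_n = ∑_{j=1}^{n} ( (1/(n b_n h_n²)) ∫₀¹ M(u) H'((m(u) − t)/h_n) K̄((j/n − u)/b_n) du )². Then lim_{n→∞} n·b_n³·Q_n = (M(m⁻¹(t))² / m'(m⁻¹(t))⁴) · (∫_{−1}^{1} y H'(y) dy)² · ∫_{−1}^{1} K̄'(y)² dy. -/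
open Set Filter Topology MeasureTheory

lemma aux_count (n : ℕ) (x r : ℝ) (hr : 0 ≤ r) :
    (((Finset.Icc 1 n).filter (fun j : ℕ => |(j:ℝ) - x| ≤ r)).card : ℝ) ≤ 2 * r + 1 := by
  have hinj : ((Finset.Icc 1 n).filter (fun j : ℕ => |(j:ℝ) - x| ≤ r)).card ≤
      (Finset.Icc ⌈x - r⌉ ⌊x + r⌋).card := by
    apply Finset.card_le_card_of_injOn (fun j : ℕ => (j : ℤ))
    · intro j hj
      simp only [Finset.coe_filter, mem_ofPred_eq] at hj
      have := abs_le.1 hj.2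
      simp only [Finset.coe_Icc, mem_Icc, Int.ceil_le, Int.le_floor, Int.cast_natCast]
      constructor <;> linarith
    · intro a _ c _ hac
      simpa using hac
  rw [Int.card_Icc] at hinj
  have h2 : (((⌊x + r⌋ + 1 - ⌈x - r⌉).toNat : ℤ) : ℝ) ≤ 2 * r + 1 := by
    rw [Int.toNat_eq_max]
    push_cast
    apply max_le _ (by linarith)
    have := Int.floor_le (x + r)
    have := Int.le_ceil (x - r)
    linarith
  have h3 : (((Finset.Icc 1 n).filter (fun j : ℕ => |(j:ℝ) - x| ≤ r)).card : ℝ) ≤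
    (((⌊x + r⌋ + 1 - ⌈x - r⌉).toNat : ℤ) : ℝ) := by exact_mod_cast hinj
  linarith

lemma aux_avg (x0 : ℝ) (b : ℕ → ℝ) (hb : ∀ n, 0 < b n)
    (hnb : Tendsto (fun n : ℕ => (n : ℝ) * b n) atTop atTop) (e : ℕ → ℕ → ℝ)
    (he : ∀ ε > 0, ∀ᶠ n in atTop, ∀ j ∈ Finset.Icc 1 n, |e n j| ≤ ε ∧
      (2 < |((j:ℝ) / (n:ℝ) - x0) / b n| → e n j = 0)) :
    Tendsto (fun n : ℕ => 1 / ((n:ℝ) * b n) * ∑ j ∈ Finset.Icc 1 n, e n j) atTop (𝓝 0) := by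
  rw [Metric.tendsto_atTop']
  intro ε hε
  have h1 := he (ε / 10) (by positivity)
  have h2 := hnb.eventually_ge_atTop 1
  obtain ⟨N, hN⟩ := eventually_atTop.1 (h1.and (h2.and (eventually_gt_atTop 0)))
  refine ⟨N, fun n hn => ?_⟩
  obtain ⟨h1, h2, hn0⟩ := hN n hn.le
  have hn' : (0:ℝ) < n := by exact_mod_cast hn0
  have hbn := hb n
  rw [Real.dist_eq, sub_zero, abs_mul, abs_of_pos (by positivity)]
  set s := (Finset.Icc 1 n).filter (fun j : ℕ => |(j:ℝ) - n * x0| ≤ 2 * (n * b n)) with hs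
  have hsum : ∑ j ∈ s, e n j = ∑ j ∈ Finset.Icc 1 n, e n j := by
    apply Finset.sum_subset (Finset.filter_subset _ _)
    intro j hj hj'
    apply (h1 j hj).2
    simp only [s, Finset.mem_filter, hj, true_and, not_le] at hj'
    rw [abs_div, abs_of_pos hbn, lt_div_iff₀ hbn]
    have : (j:ℝ) / n - x0 = (j - n * x0) / n := by field_simp
    rw [this, abs_div, abs_of_pos hn', lt_div_iff₀ hn']
    linarith
  rw [← hsum]
  have h3 : |∑ j ∈ s, e n j| ≤ s.card * (ε / 10) := by
    refine (Finset.abs_sum_le_sum_abs _ _).trans ?_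
    rw [← nsmul_eq_mul]
    exact Finset.sum_le_card_nsmul _ _ _ (fun j hj => (h1 j (Finset.filter_subset _ _ hj)).1)
  have h4 := aux_count n (n * x0) (2 * (n * b n)) (by positivity)
  rw [← hs] at h4
  rw [one_div, inv_mul_lt_iff₀ (by positivity)]
  nlinarith

lemma aux_supp_int (f : ℝ → ℝ) (hf0 : ∀ y, 1 ≤ |y| → f y = 0) (A B : ℝ)
    (hA : A ≤ -1) (hB : 1 ≤ B) : ∫ y in A..B, f y = ∫ y in (-1:ℝ)..1, f y := by
  have hsupp : Function.support f ⊆ Ioc (-1) 1 := by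
    intro y hy
    by_contra hcon
    apply hy
    apply hf0
    rw [le_abs]
    simp only [mem_Ioc, not_and_or, not_lt, not_le] at hcon
    rcases hcon with h | h
    · right; linarith
    · left; linarith
  rw [intervalIntegral.integral_eq_integral_of_support_subset hsupp,
    intervalIntegral.integral_eq_integral_of_support_subset
      (hsupp.trans (Ioc_subset_Ioc hA hB))]

lemma aux_zero (f : ℝ → ℝ) (hf : Continuous f) (h : ∀ y, 1 < |y| → f y = 0) :
    ∀ y, 1 ≤ |y| → f y = 0 := by
  have hc : IsClosed {y | f y = 0} := isClosed_eq hf continuous_const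
  intro y hy
  have h1 : Tendsto (fun k : ℝ => k * y) (𝓝[>] 1) (𝓝 y) := by
    have : Tendsto (fun k : ℝ => k * y) (𝓝 1) (𝓝 (1 * y)) := by
      apply Continuous.tendsto; fun_prop
    rw [one_mul] at this
    exact this.mono_left nhdsWithin_le_nhds
  refine hc.mem_of_tendsto h1 ?_
  filter_upwards [self_mem_nhdsWithin] with k hk
  apply h
  have hk : (1:ℝ) < k := hk
  rw [abs_mul, abs_of_pos (by linarith)]
  nlinarith

lemma aux_deriv_zero (f f' : ℝ → ℝ) (hf : ∀ y, HasDerivAt f (f' y) y) (hf' : Continuous f')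
    (hs : Function.support f ⊆ Icc (-1) 1) :
    (∀ y, 1 ≤ |y| → f y = 0) ∧ (∀ y, 1 ≤ |y| → f' y = 0) := by
  have h0 : ∀ y, 1 < |y| → f y = 0 := by
    intro y hy
    by_contra hc
    have := abs_le.2 (hs hc)
    linarith
  refine ⟨aux_zero f (continuous_iff_continuousAt.2 fun y => (hf y).continuousAt) h0,
    aux_zero f' hf' ?_⟩
  intro y hy
  have : f =ᶠ[𝓝 y] fun _ => 0 := by
    have : ∀ᶠ z in 𝓝 y, 1 < |z| := continuous_abs.continuousAt.eventually_const_lt hy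
    filter_upwards [this] with z hz using h0 z hz
  exact (hf y).unique ((hasDerivAt_const y (0:ℝ)).congr_of_eventuallyEq this)

lemma aux_unif (f : ℝ → ℝ) (hf : Continuous f) (hf0 : ∀ y, 1 ≤ |y| → f y = 0) :
    UniformContinuous f ∧ ∃ B, 0 < B ∧ ∀ y, |f y| ≤ B := by
  have hcs : HasCompactSupport f := by
    apply HasCompactSupport.of_support_subset_isCompact (isCompact_Icc (a := (-1:ℝ)) (b := 1))
    intro y hy
    rw [mem_Icc, ← abs_le]
    by_contra hc
    exact hy (hf0 y (not_le.1 hc).le)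
  refine ⟨hcs.uniformContinuous_of_continuous hf, ?_⟩
  obtain ⟨C, hC⟩ := hcs.exists_bound_of_continuous hf
  exact ⟨max C 1, by positivity, fun y => (hC y).trans (le_max_left _ _)⟩

lemma aux_riemann_s15 (x0 : ℝ) (hx0 : x0 ∈ Ioo (0:ℝ) 1) (b : ℕ → ℝ) (hb : ∀ n, 0 < b n)
    (hb0 : Tendsto b atTop (𝓝 0))
    (hnb : Tendsto (fun n : ℕ => (n : ℝ) * b n) atTop atTop) (f : ℝ → ℝ)
    (hf : Continuous f) (hf0 : ∀ y, 1 ≤ |y| → f y = 0) :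
    Tendsto (fun n : ℕ => 1 / ((n:ℝ) * b n) *
      ∑ j ∈ Finset.Icc 1 n, f (((j:ℝ) / (n:ℝ) - x0) / b n)) atTop
      (𝓝 (∫ y in (-1:ℝ)..1, f y)) := by
  let p : ℕ → ℕ → ℝ := fun n j => ((j:ℝ) / (n:ℝ) - x0) / b n
  have hB := aux_avg x0 b hb hnb (fun n j => f (p n j) -
    ((n:ℝ) * b n) * ∫ y in (p n (j-1))..(p n j), f y) ?_
  · have h2 : Tendsto (fun n : ℕ => ∫ y in (p n 0)..(p n n), f y) atTop
        (𝓝 (∫ y in (-1:ℝ)..1, f y)) := by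
      apply tendsto_const_nhds.congr'
      filter_upwards [hb0.eventually_lt_const hx0.1,
        hb0.eventually_lt_const (sub_pos.2 hx0.2), eventually_gt_atTop 0] with n h1 h2 h3
      symm
      apply aux_supp_int f hf0
      · simp only [p]
        rw [div_le_iff₀ (hb n)]
        simp; linarith
      · simp only [p]
        rw [le_div_iff₀ (hb n), div_self (by positivity)]
        linarith
    have h3 := hB.add h2
    rw [zero_add] at h3
    apply h3.congr'
    filter_upwards [eventually_gt_atTop 0] with n hn
    have hn' : (0:ℝ) < n := by exact_mod_cast hn
    have hbn := hb n
    rw [Finset.sum_sub_distrib, ← Finset.mul_sum, mul_sub, ← mul_assoc, one_div,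
      inv_mul_cancel₀ (by positivity), one_mul]
    have : ∑ j ∈ Finset.Icc 1 n, ∫ y in (p n (j-1))..(p n j), f y =
        ∫ y in (p n 0)..(p n n), f y := by
      rw [← intervalIntegral.sum_integral_adjacent_intervals
        (fun k _ => hf.intervalIntegrable _ _)]
      rw [Finset.range_eq_Ico, Finset.sum_Ico_eq_sum_range, ]
      rw [← Finset.Ico_succ_right_eq_Icc, Finset.sum_Ico_eq_sum_range]
      apply Finset.sum_congr (by simp)
      intro k _
      rw [show 1 + k - 1 = k by omega, zero_add, add_comm 1 k]
    rw [this]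
    simp only [p]
    ring
  · intro ε hε
    obtain ⟨δ, hδ, hfu⟩ := Metric.uniformContinuous_iff.1 (aux_unif f hf hf0).1 ε hε
    filter_upwards [hnb.eventually_gt_atTop (1/δ), hnb.eventually_ge_atTop 1,
      eventually_gt_atTop 0] with n h1 h2 hn j hj
    have hn' : (0:ℝ) < n := by exact_mod_cast hn
    have hbn := hb n
    have hj1 := (Finset.mem_Icc.1 hj).1
    have hstep : p n j - p n (j-1) = 1 / (n * b n) := by
      simp only [p]
      rw [Nat.cast_sub hj1]
      field_simp
      push_cast
      ring
    have hpos : 0 < 1 / ((n:ℝ) * b n) := by positivity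
    have hle : p n (j-1) ≤ p n j := by linarith
    have hd : 1 / ((n:ℝ) * b n) < δ := by
      rw [div_lt_iff₀ (by positivity)]
      rw [div_lt_iff₀ hδ] at h1
      linarith
    constructor
    · have hcst : f (p n j) = ((n:ℝ) * b n) * ∫ y in (p n (j-1))..(p n j), f (p n j) := by
        rw [intervalIntegral.integral_const, hstep, smul_eq_mul]
        field_simp
      have : f (p n j) - ((n:ℝ) * b n) * ∫ y in (p n (j-1))..(p n j), f y =
        ((n:ℝ) * b n) * ∫ y in (p n (j-1))..(p n j), (f (p n j) - f y) := by
        rw [intervalIntegral.integral_sub (by simp) (hf.intervalIntegrable _ _), mul_sub, ← hcst]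
      rw [this, abs_mul, abs_of_pos (by positivity)]
      have hb1 := intervalIntegral.norm_integral_le_of_norm_le_const
        (f := fun y => f (p n j) - f y) (C := ε) (a := p n (j-1)) (b := p n j) (by
          intro y hy
          rw [uIoc_of_le hle] at hy
          rw [← dist_eq_norm]
          apply (hfu _).le
          rw [Real.dist_eq, abs_of_nonneg (by linarith [hy.2])]
          linarith [hy.1])
      rw [hstep, abs_of_pos hpos, Real.norm_eq_abs] at hb1
      calc _ ≤ ((n:ℝ) * b n) * (ε * (1 / ((n:ℝ) * b n))) := by gcongr
        _ = ε := by field_simp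
    · intro h4
      have h4 : 2 < |p n j| := h4
      have hlt1 : 1 / ((n:ℝ) * b n) ≤ 1 := by
        rw [div_le_one (by positivity)]; exact h2
      rw [hf0 _ (by linarith), intervalIntegral.integral_zero_ae]
      · simp
      · refine Eventually.of_forall fun y hy => hf0 y ?_
        rw [uIoc_of_le hle] at hy
        rw [le_abs]
        rcases lt_abs.1 h4 with h | h
        · left; linarith [hy.1]
        · right; linarith [hy.2]

lemma aux_ibp (m m' g g' H H' K K' : ℝ → ℝ) (t a b h : ℝ) (hb : 0 < b) (hh : 0 < h)
    (hmd : ∀ x ∈ Icc (0:ℝ) 1, HasDerivAt m (m' x) x) (hm'c : ContinuousOn m' (Icc 0 1))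
    (hg : ∀ x ∈ Icc (0:ℝ) 1, HasDerivAt g (g' x) x) (hg'c : ContinuousOn g' (Icc 0 1))
    (hHd : ∀ y, HasDerivAt H (H' y) y) (hH'c : Continuous H')
    (hH0 : ∀ y, 1 ≤ |y| → H y = 0)
    (hKd : ∀ y, HasDerivAt K (K' y) y) (hK'c : Continuous K')
    (h0 : h ≤ t - m 0) (h1 : h ≤ m 1 - t) :
    b / h ^ 2 * (∫ u in (0:ℝ)..1, (g u * m' u) * H' ((m u - t) / h) * K ((a - u) / b)) =
      ∫ u in (0:ℝ)..1, (g u * K' ((a - u) / b) - b * g' u * K ((a - u) / b)) *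
        (H ((m u - t) / h) / h) := by
  have hu01 : uIcc (0:ℝ) 1 = Icc 0 1 := uIcc_of_le zero_le_one
  have hKc : Continuous K := continuous_iff_continuousAt.2 fun y => (hKd y).continuousAt
  have hmc : ContinuousOn m (Icc 0 1) := fun x hx => (hmd x hx).continuousAt.continuousWithinAt
  have hgc : ContinuousOn g (Icc 0 1) := fun x hx => (hg x hx).continuousAt.continuousWithinAt
  have hka : Continuous fun u : ℝ => K ((a - u) / b) := by fun_prop
  have hka' : Continuous fun u : ℝ => K' ((a - u) / b) := by fun_prop
  have hH'm : ContinuousOn (fun u => H' ((m u - t) / h)) (Icc 0 1) :=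
    hH'c.comp_continuousOn ((hmc.sub continuousOn_const).div_const h)
  have key := intervalIntegral.integral_mul_deriv_eq_deriv_mul (a := 0) (b := 1)
    (u := fun u => g u * K ((a - u) / b))
    (u' := fun u => g' u * K ((a - u) / b) + g u * (K' ((a - u) / b) * (-1 / b)))
    (v := fun u => h * H ((m u - t) / h)) (v' := fun u => h * (H' ((m u - t) / h) * (m' u / h)))
    (by
      intro x hx
      rw [hu01] at hx
      have h3 : HasDerivAt (fun u : ℝ => (a - u) / b) (-1 / b) x :=
        ((hasDerivAt_id x).const_sub a).div_const b
      exact (hg x hx).mul ((hKd _).comp x h3))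
    (by
      intro x hx
      rw [hu01] at hx
      have h3 : HasDerivAt (fun u : ℝ => (m u - t) / h) (m' x / h) x :=
        ((hmd x hx).sub_const t).div_const h
      exact ((hHd _).comp x h3).const_mul h)
    (by
      apply ContinuousOn.intervalIntegrable
      rw [hu01]
      exact (hg'c.mul hka.continuousOn).add (hgc.mul (hka'.continuousOn.mul continuousOn_const)))
    (by
      apply ContinuousOn.intervalIntegrable
      rw [hu01]
      exact continuousOn_const.mul (hH'm.mul (hm'c.div_const h)))
  have hz0 : H ((m 0 - t) / h) = 0 := by
    apply hH0
    rw [abs_div, abs_of_pos hh, le_div_iff₀ hh, le_abs]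
    right; linarith
  have hz1 : H ((m 1 - t) / h) = 0 := by
    apply hH0
    rw [abs_div, abs_of_pos hh, le_div_iff₀ hh, le_abs]
    left; linarith
  simp only [hz0, hz1, mul_zero, sub_zero, zero_sub] at key
  have e1 : (∫ u in (0:ℝ)..1, (g u * m' u) * H' ((m u - t) / h) * K ((a - u) / b)) =
      ∫ x in (0:ℝ)..1, g x * K ((a - x) / b) * (h * (H' ((m x - t) / h) * (m' x / h))) := by
    congr 1; ext u; field_simp
  rw [e1, key, ← intervalIntegral.integral_neg, ← intervalIntegral.integral_const_mul]
  congr 1; ext u; field_simp; ring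

lemma aux_cov (m m' H : ℝ → ℝ) (t h : ℝ) (hh : 0 < h)
    (hmd : ∀ x ∈ Icc (0:ℝ) 1, HasDerivAt m (m' x) x) (hm'c : ContinuousOn m' (Icc 0 1))
    (hHc : Continuous H) (hH0 : ∀ y, 1 ≤ |y| → H y = 0)
    (h0 : h ≤ t - m 0) (h1 : h ≤ m 1 - t) :
    ∫ u in (0:ℝ)..1, m' u * (H ((m u - t) / h) / h) = ∫ y in (-1:ℝ)..1, H y := by
  have hu01 : uIcc (0:ℝ) 1 = Icc 0 1 := uIcc_of_le zero_le_one
  have := intervalIntegral.integral_comp_mul_deriv (a := 0) (b := 1)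
    (f := fun u => (m u - t) / h) (f' := fun u => m' u / h) (g := H)
    (by
      intro x hx
      rw [hu01] at hx
      exact ((hmd x hx).sub_const t).div_const h)
    (by rw [hu01]; exact hm'c.div_const h) hHc
  rw [aux_supp_int H hH0 _ _ (by rw [div_le_iff₀ hh]; linarith)
    (by rw [le_div_iff₀ hh]; linarith)] at this
  rw [← this]
  congr 1; ext u; simp only [Function.comp]; ring

lemma aux_err (m m' H P : ℝ → ℝ) (t h C ε : ℝ) (hh : 0 < h)
    (hmd : ∀ x ∈ Icc (0:ℝ) 1, HasDerivAt m (m' x) x) (hm'c : ContinuousOn m' (Icc 0 1))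
    (hHc : Continuous H) (hH0 : ∀ y, 1 ≤ |y| → H y = 0)
    (h0 : h ≤ t - m 0) (h1 : h ≤ m 1 - t) (hP : ContinuousOn P (Icc 0 1))
    (hPC : ∀ u ∈ Icc (0:ℝ) 1, |m u - t| < h → |P u - C * m' u| ≤ ε * m' u) :
    |(∫ u in (0:ℝ)..1, P u * (H ((m u - t) / h) / h)) - C * ∫ y in (-1:ℝ)..1, H y| ≤
      ε * ∫ y in (-1:ℝ)..1, |H y| := by
  have hu01 : uIcc (0:ℝ) 1 = Icc 0 1 := uIcc_of_le zero_le_one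
  have hmc : ContinuousOn m (Icc 0 1) := fun x hx => (hmd x hx).continuousAt.continuousWithinAt
  have hHm : ContinuousOn (fun u => H ((m u - t) / h) / h) (Icc 0 1) :=
    (hHc.comp_continuousOn ((hmc.sub continuousOn_const).div_const h)).div_const h
  rw [← aux_cov m m' H t h hh hmd hm'c hHc hH0 h0 h1,
    ← aux_cov m m' (fun y => |H y|) t h hh hmd hm'c hHc.abs (by simpa using hH0) h0 h1,
    ← intervalIntegral.integral_const_mul, ← intervalIntegral.integral_const_mul,
    ← intervalIntegral.integral_sub, ← Real.norm_eq_abs]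
  · apply intervalIntegral.norm_integral_le_of_norm_le zero_le_one
    · refine Eventually.of_forall fun u hu => ?_
      have hu : u ∈ Icc (0:ℝ) 1 := ⟨hu.1.le, hu.2⟩
      have e1 : P u * (H ((m u - t) / h) / h) - C * (m' u * (H ((m u - t) / h) / h)) =
        (P u - C * m' u) * (H ((m u - t) / h) / h) := by ring
      rw [e1, norm_mul, Real.norm_eq_abs, Real.norm_eq_abs, abs_div, abs_of_pos hh, ← mul_assoc]
      by_cases hc : |m u - t| < h
      · exact mul_le_mul_of_nonneg_right (hPC u hu hc) (by positivity)
      · rw [hH0 ((m u - t) / h) (by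
          rw [abs_div, abs_of_pos hh, le_div_iff₀ hh]; linarith)]
        simp
    · apply ContinuousOn.intervalIntegrable
      rw [hu01]
      exact continuousOn_const.mul (hm'c.mul
        ((hHc.abs.comp_continuousOn ((hmc.sub continuousOn_const).div_const h)).div_const h))
  · apply ContinuousOn.intervalIntegrable
    rw [hu01]
    exact hP.mul hHm
  · apply ContinuousOn.intervalIntegrable
    rw [hu01]
    exact continuousOn_const.mul (hm'c.mul hHm)

lemma aux_dist (m m' : ℝ → ℝ) (c : ℝ)
    (hmd : ∀ x ∈ Icc (0:ℝ) 1, HasDerivAt m (m' x) x)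
    (hc : ∀ x ∈ Icc (0:ℝ) 1, c ≤ m' x) (x y : ℝ) (hx : x ∈ Icc (0:ℝ) 1)
    (hy : y ∈ Icc (0:ℝ) 1) : c * |y - x| ≤ |m y - m x| := by
  have key := (convex_Icc (0:ℝ) 1).mul_sub_le_image_sub_of_le_deriv
    (fun x hx => (hmd x hx).continuousAt.continuousWithinAt)
    (fun x hx => (hmd x (interior_subset hx)).differentiableAt.differentiableWithinAt)
    (C := c) (fun x hx => by
      rw [(hmd x (interior_subset hx)).deriv]; exact hc x (interior_subset hx))
  rcases le_total x y with h | h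
  · rw [abs_of_nonneg (sub_nonneg.2 h)]
    exact (key x hx y hy h).trans (le_abs_self _)
  · rw [abs_sub_comm, abs_of_nonneg (sub_nonneg.2 h), abs_sub_comm (m y)]
    exact (key y hy x hx h).trans (le_abs_self _)

lemma aux_unifP (m m' g g' K K' : ℝ → ℝ) (t x0 c : ℝ) (b h : ℕ → ℝ)
    (hb : ∀ n, 0 < b n) (hb0 : Tendsto b atTop (𝓝 0)) (hh0 : Tendsto h atTop (𝓝 0))
    (hhb : Tendsto (fun n : ℕ => h n / b n) atTop (𝓝 0))
    (hc0 : 0 < c) (hc : ∀ x ∈ Icc (0:ℝ) 1, c ≤ m' x)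
    (hx0 : x0 ∈ Icc (0:ℝ) 1) (hx0t : m x0 = t)
    (hmd : ∀ x ∈ Icc (0:ℝ) 1, HasDerivAt m (m' x) x) (hm'c : ContinuousOn m' (Icc 0 1))
    (hgc : ContinuousOn g (Icc 0 1)) (hg'c : ContinuousOn g' (Icc 0 1))
    (hKc : Continuous K) (hK0 : ∀ y, 1 ≤ |y| → K y = 0)
    (hK'c : Continuous K') (hK'0 : ∀ y, 1 ≤ |y| → K' y = 0) (ε : ℝ) (hε : 0 < ε) :
    ∀ᶠ n in atTop, ∀ a : ℝ, ∀ u ∈ Icc (0:ℝ) 1, |m u - t| < h n →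
      |(g u * K' ((a - u) / b n) - b n * g' u * K ((a - u) / b n)) -
        (g x0 / m' x0 * K' ((a - x0) / b n)) * m' u| ≤ ε * m' u := by
  obtain ⟨hKu, BK, hBK, hKb⟩ := aux_unif K hKc hK0
  obtain ⟨hK'u, BK', hBK', hK'b⟩ := aux_unif K' hK'c hK'0
  obtain ⟨G, hG⟩ := isCompact_Icc.exists_bound_of_continuousOn hgc
  obtain ⟨G', hG'⟩ := isCompact_Icc.exists_bound_of_continuousOn hg'c
  have hG0 : 0 ≤ G := (norm_nonneg _).trans (hG x0 hx0)
  have hG'0 : 0 ≤ G' := (norm_nonneg _).trans (hG' x0 hx0)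
  set c0 := g x0 / m' x0 with hc0d
  have hr : ContinuousOn (fun u => g u - c0 * m' u) (Icc 0 1) :=
    hgc.sub (continuousOn_const.mul hm'c)
  have hr0 : g x0 - c0 * m' x0 = 0 := by
    have := (hc0.trans_le (hc x0 hx0)).ne'
    rw [hc0d]; field_simp; ring
  set η := ε * c / 3 with hη
  have hηp : 0 < η := by positivity
  obtain ⟨δ1, hδ1, hd1⟩ := Metric.continuousOn_iff.1 hr x0 hx0 (η / BK') (by positivity)
  obtain ⟨δ2, hδ2, hd2⟩ := Metric.uniformContinuous_iff.1 hK'u (η / (G + 1)) (by positivity)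
  have hbs : Tendsto (fun n => b n * (G' * BK)) atTop (𝓝 0) := by
    simpa using hb0.mul_const (G' * BK)
  filter_upwards [hh0.eventually_lt_const (show 0 < c * δ1 by positivity),
    hhb.eventually_lt_const (show 0 < c * δ2 by positivity),
    hbs.eventually_lt_const hηp] with n e1 e2 e3 a u hu hmu
  have hbn := hb n
  have hdist := aux_dist m m' c hmd hc x0 u hx0 hu
  rw [hx0t] at hdist
  have hux : |u - x0| < δ1 := by
    have : c * |u - x0| < c * δ1 := by linarith
    exact lt_of_mul_lt_mul_left this hc0.le
  have hux2 : |u - x0| / b n < δ2 := by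
    rw [div_lt_iff₀ hbn] at e2 ⊢
    have : c * |u - x0| < c * (δ2 * b n) := by linarith
    exact lt_of_mul_lt_mul_left this hc0.le
  have f1 : |g u - c0 * m' u| < η / BK' := by
    have := hd1 u hu (by rwa [Real.dist_eq])
    rwa [Real.dist_eq, hr0, sub_zero] at this
  have f2 : |K' ((a - u) / b n) - K' ((a - x0) / b n)| < η / (G + 1) := by
    have := hd2 (a := (a - u) / b n) (b := (a - x0) / b n) (by
      rw [Real.dist_eq, ← sub_div, abs_div, abs_of_pos hbn]
      rwa [show a - u - (a - x0) = -(u - x0) by ring, abs_neg])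
    rwa [Real.dist_eq] at this
  have e : (g u * K' ((a - u) / b n) - b n * g' u * K ((a - u) / b n)) -
        (c0 * K' ((a - x0) / b n)) * m' u =
      g u * (K' ((a - u) / b n) - K' ((a - x0) / b n)) +
      (g u - c0 * m' u) * K' ((a - x0) / b n) - b n * (g' u * K ((a - u) / b n)) := by ring
  rw [e]
  have g1 : |g u * (K' ((a - u) / b n) - K' ((a - x0) / b n))| ≤ η := by
    rw [abs_mul]
    calc _ ≤ (G + 1) * (η / (G + 1)) := by
          gcongr
          exact (hG u hu).trans (by linarith)
      _ = η := by field_simp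
  have g2 : |(g u - c0 * m' u) * K' ((a - x0) / b n)| ≤ η := by
    rw [abs_mul]
    calc _ ≤ (η / BK') * BK' := by
          gcongr
          exact hK'b _
      _ = η := by field_simp
  have g3 : |b n * (g' u * K ((a - u) / b n))| ≤ η := by
    rw [abs_mul, abs_mul, abs_of_pos hbn]
    refine le_trans ?_ e3.le
    gcongr
    · exact hG' u hu
    · exact hKb _
  have g4 : ε * c ≤ ε * m' u := mul_le_mul_of_nonneg_left (hc u hu) hε.le
  refine (abs_sub _ _).trans ?_
  have := abs_add_le (g u * (K' ((a - u) / b n) - K' ((a - x0) / b n)))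
    ((g u - c0 * m' u) * K' ((a - x0) / b n))
  linarith

/-- Pointwise variance limit of the Gaussian surrogate process (Step 1 of the proof of
Theorem 3.2): with `Qₙ = ∑_{j=1}^{n} ((1/(n bₙ hₙ²)) ∫₀¹ M(u) H'((m(u)-t)/hₙ)
K̄((j/n - u)/bₙ) du)²`, one has
`n bₙ³ Qₙ → (M(m⁻¹(t))²/m'(m⁻¹(t))⁴)(∫ y H'(y) dy)² ∫ K̄'(y)² dy`. -/
theorem stmt_15
    (m m' m'' i Mc Mc' H H' Kb Kb' : ℝ → ℝ) (t : ℝ)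
    (hmd : ∀ x ∈ Icc (0:ℝ) 1, HasDerivAt m (m' x) x)
    (hmd2 : ∀ x ∈ Icc (0:ℝ) 1, HasDerivAt m' (m'' x) x)
    (hm''c : ContinuousOn m'' (Icc 0 1))
    (hm'pos : ∀ x ∈ Icc (0:ℝ) 1, 0 < m' x)
    (hMd : ∀ x ∈ Icc (0:ℝ) 1, HasDerivAt Mc (Mc' x) x)
    (hM'c : ContinuousOn Mc' (Icc 0 1))
    (hHd : ∀ y, HasDerivAt H (H' y) y) (hH'c : Continuous H')
    (hHsupp : Function.support H ⊆ Icc (-1) 1)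
    (hKd : ∀ y, HasDerivAt Kb (Kb' y) y) (hK'c : Continuous Kb')
    (hKsupp : Function.support Kb ⊆ Icc (-1) 1)
    (hi : ∀ x ∈ Icc (0:ℝ) 1, i (m x) = x)
    (hi' : ∀ u ∈ Icc (m 0) (m 1), i u ∈ Icc (0:ℝ) 1 ∧ m (i u) = u)
    (ht : t ∈ Ioo (m 0) (m 1))
    (b h : ℕ → ℝ) (hb : ∀ n, 0 < b n) (hh : ∀ n, 0 < h n)
    (hb0 : Tendsto b atTop (𝓝 0))
    (hh0 : Tendsto h atTop (𝓝 0))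
    (hnb : Tendsto (fun n : ℕ => (n : ℝ) * b n) atTop atTop)
    (hhb : Tendsto (fun n : ℕ => h n / b n) atTop (𝓝 0)) :
    Tendsto
      (fun n : ℕ => (n : ℝ) * (b n) ^ 3 *
        ∑ j ∈ Finset.Icc 1 n,
          ((1 / ((n : ℝ) * b n * (h n) ^ 2)) *
            ∫ u in (0:ℝ)..1,
              Mc u * H' ((m u - t) / h n) * Kb (((j : ℝ) / (n : ℝ) - u) / b n)) ^ 2)
      atTop
      (𝓝 ((Mc (i t)) ^ 2 / (m' (i t)) ^ 4 * (∫ y in (-1:ℝ)..1, y * H' y) ^ 2 *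
        ∫ y in (-1:ℝ)..1, (Kb' y) ^ 2)) := by
  have hu01 : uIcc (0:ℝ) 1 = Icc 0 1 := uIcc_of_le zero_le_one
  obtain ⟨hH0, hH'0⟩ := aux_deriv_zero H H' hHd hH'c hHsupp
  obtain ⟨hK0, hK'0⟩ := aux_deriv_zero Kb Kb' hKd hK'c hKsupp
  have hHc : Continuous H := continuous_iff_continuousAt.2 fun y => (hHd y).continuousAt
  have hKc : Continuous Kb := continuous_iff_continuousAt.2 fun y => (hKd y).continuousAt
  have hm'c : ContinuousOn m' (Icc 0 1) :=
    fun x hx => (hmd2 x hx).continuousAt.continuousWithinAt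
  have hMc : ContinuousOn Mc (Icc 0 1) :=
    fun x hx => (hMd x hx).continuousAt.continuousWithinAt
  obtain ⟨hx0, hx0t⟩ := hi' t ⟨ht.1.le, ht.2.le⟩
  set x0 := i t with hx0d
  have hx0' : x0 ∈ Ioo (0:ℝ) 1 := by
    refine ⟨lt_of_le_of_ne hx0.1 ?_, lt_of_le_of_ne hx0.2 ?_⟩
    · intro hcon
      rw [← hcon] at hx0t
      exact absurd hx0t ht.1.ne
    · intro hcon
      rw [hcon] at hx0t
      exact absurd hx0t ht.2.ne'
  obtain ⟨xm, hxm, hmin⟩ := isCompact_Icc.exists_isMinOn ⟨x0, hx0⟩ hm'c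
  have hc0 : 0 < m' xm := hm'pos xm hxm
  have hc : ∀ x ∈ Icc (0:ℝ) 1, m' xm ≤ m' x := fun x hx => hmin hx
  set c := m' xm
  let g : ℝ → ℝ := fun u => Mc u / m' u
  let g' : ℝ → ℝ := fun u => (Mc' u * m' u - Mc u * m'' u) / m' u ^ 2
  have hg : ∀ x ∈ Icc (0:ℝ) 1, HasDerivAt g (g' x) x :=
    fun x hx => (hMd x hx).div (hmd2 x hx) (hm'pos x hx).ne'
  have hgc : ContinuousOn g (Icc 0 1) := fun x hx => (hg x hx).continuousAt.continuousWithinAt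
  have hg'c : ContinuousOn g' (Icc 0 1) :=
    ((hM'c.mul hm'c).sub (hMc.mul hm''c)).div (hm'c.pow 2)
      (fun x hx => pow_ne_zero 2 (hm'pos x hx).ne')
  set c0 := g x0 / m' x0 with hc0d
  set A := ∫ y in (-1:ℝ)..1, H y with hA
  have hyH : ∫ y in (-1:ℝ)..1, y * H' y = -A := by
    have := intervalIntegral.integral_mul_deriv_eq_deriv_mul (a := -1) (b := 1)
      (u := fun y => y) (u' := fun _ => 1) (v := H) (v' := H')
      (fun x _ => hasDerivAt_id x) (fun x _ => hHd x) (by simp) (hH'c.intervalIntegrable _ _)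
    rw [this, hH0 1 (by simp), hH0 (-1) (by simp)]
    simp [hA]
  let p : ℕ → ℕ → ℝ := fun n j => ((j : ℝ) / (n : ℝ) - x0) / b n
  let S : ℕ → ℕ → ℝ := fun n j => b n / h n ^ 2 * ∫ u in (0:ℝ)..1,
              Mc u * H' ((m u - t) / h n) * Kb (((j : ℝ) / (n : ℝ) - u) / b n)
  obtain ⟨-, BK', hBK', hK'b⟩ := aux_unif Kb' hK'c hK'0
  have hIabs : 0 ≤ ∫ y in (-1:ℝ)..1, |H y| :=
    intervalIntegral.integral_nonneg (by norm_num) (fun _ _ => abs_nonneg _)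
  set IA := ∫ y in (-1:ℝ)..1, |H y|
  have hIA1 : 0 < IA + 1 := by linarith
  -- error control for S
  have hS : ∀ ε > 0, ∀ᶠ n in atTop, ∀ j ∈ Finset.Icc 1 n,
      |S n j - c0 * Kb' (p n j) * A| ≤ ε ∧
      (2 < |p n j| → S n j = 0 ∧ Kb' (p n j) = 0) := by
    intro ε hε
    filter_upwards [aux_unifP m m' g g' Kb Kb' t x0 c b h hb hb0 hh0 hhb hc0 hc hx0 hx0t hmd hm'c
      hgc hg'c hKc hK0 hK'c hK'0 (ε / (IA + 1)) (by positivity),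
      hhb.eventually_lt_const hc0, hh0.eventually_lt_const (sub_pos.2 ht.1),
      hh0.eventually_lt_const (sub_pos.2 ht.2)] with n hP hbc h0 h1 j hj
    have hbn := hb n
    have hS1 : S n j = ∫ u in (0:ℝ)..1, (g u * Kb' (((j : ℝ) / (n : ℝ) - u) / b n) -
        b n * g' u * Kb (((j : ℝ) / (n : ℝ) - u) / b n)) * (H ((m u - t) / h n) / h n) := by
      rw [← aux_ibp m m' g g' H H' Kb Kb' t _ (b n) (h n) (hb n) (hh n) hmd hm'c hg hg'c hHd hH'c
        hH0 hKd hK'c h0.le h1.le]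
      simp only [S]
      congr 1
      apply intervalIntegral.integral_congr
      intro u hu
      rw [hu01] at hu
      have := (hm'pos u hu).ne'
      simp only [g]
      rw [div_mul_cancel₀ _ this]
    have hPc : ContinuousOn (fun u => g u * Kb' (((j : ℝ) / (n : ℝ) - u) / b n) -
        b n * g' u * Kb (((j : ℝ) / (n : ℝ) - u) / b n)) (Icc 0 1) := by
      have k1 : Continuous fun u : ℝ => Kb (((j : ℝ) / (n : ℝ) - u) / b n) := by fun_prop
      have k2 : Continuous fun u : ℝ => Kb' (((j : ℝ) / (n : ℝ) - u) / b n) := by fun_prop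
      exact (hgc.mul k2.continuousOn).sub ((continuousOn_const.mul hg'c).mul k1.continuousOn)
    constructor
    · rw [hS1]
      refine (aux_err m m' H _ t (h n) (c0 * Kb' (p n j)) (ε / (IA + 1)) (hh n) hmd hm'c hHc hH0
        h0.le h1.le hPc (fun u hu hmu => hP _ u hu hmu)).trans ?_
      rw [div_mul_eq_mul_div, div_le_iff₀ hIA1]
      exact mul_le_mul_of_nonneg_left (by linarith) hε.le
    · intro hp
      refine ⟨?_, hK'0 _ (by linarith)⟩
      have := aux_err m m' H _ t (h n) 0 0 (hh n) hmd hm'c hHc hH0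
        h0.le h1.le hPc (fun u hu hmu => by
          have hdist := aux_dist m m' c hmd hc x0 u hx0 hu
          rw [hx0t] at hdist
          have hux2 : |u - x0| / b n < 1 := by
            rw [div_lt_iff₀ hbn] at hbc ⊢
            have : c * |u - x0| < c * (1 * b n) := by linarith
            exact lt_of_mul_lt_mul_left this hc0.le
          have hbig : 1 ≤ |((j : ℝ) / (n : ℝ) - u) / b n| := by
            have e : p n j = ((j : ℝ) / (n : ℝ) - u) / b n + (u - x0) / b n := by
              simp only [p]; ring
            have h3 := abs_add_le (((j : ℝ) / (n : ℝ) - u) / b n) ((u - x0) / b n)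
            rw [← e, abs_div (u - x0), abs_of_pos hbn] at h3
            linarith
          simp only [hK0 _ hbig, hK'0 _ hbig]
          simp)
      rw [← hS1] at this
      simpa using this
  have hR := (aux_riemann_s15 x0 hx0' b hb hb0 hnb (fun y => (Kb' y) ^ 2) (by fun_prop)
    (fun y hy => by simp [hK'0 y hy])).const_mul ((c0 * A) ^ 2)
  have hE := aux_avg x0 b hb hnb (fun n j => S n j ^ 2 - (c0 * Kb' (p n j) * A) ^ 2) (by
    intro ε hε
    set B := |c0| * BK' * |A| with hB
    have hB0 : 0 ≤ B := by positivity
    filter_upwards [hS (min 1 (ε / (2 * B + 1))) (by positivity)] with n hn j hj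
    obtain ⟨h1, h2⟩ := hn j hj
    refine ⟨?_, fun h3 => ?_⟩
    · set w := c0 * Kb' (p n j) * A with hw
      have hwB : |w| ≤ B := by
        rw [hw, hB, abs_mul, abs_mul]
        gcongr
        exact hK'b _
      have e1 : S n j ^ 2 - w ^ 2 = (S n j - w) * ((S n j - w) + 2 * w) := by ring
      rw [e1, abs_mul]
      have h4 : |S n j - w + 2 * w| ≤ 2 * B + 1 := by
        refine (abs_add_le _ _).trans ?_
        rw [abs_mul, abs_two]
        have := h1.trans (min_le_left _ _)
        linarith
      calc _ ≤ (ε / (2 * B + 1)) * (2 * B + 1) := by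
            gcongr
            exact h1.trans (min_le_right _ _)
        _ = ε := by field_simp
    · obtain ⟨h4, h5⟩ := h2 h3
      simp only [h4, h5]; simp)
  have hfin := hE.add hR
  have hlim : Mc x0 ^ 2 / m' x0 ^ 4 * (∫ y in (-1:ℝ)..1, y * H' y) ^ 2 *
        ∫ y in (-1:ℝ)..1, (Kb' y) ^ 2 = 0 + (c0 * A) ^ 2 * ∫ y in (-1:ℝ)..1, (Kb' y) ^ 2 := by
    rw [hyH, hc0d]
    simp only [g]
    have := (hm'pos x0 hx0).ne'
    rw [zero_add]
    congr 1
    field_simp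
  rw [hlim]
  apply hfin.congr'
  filter_upwards [eventually_gt_atTop 0] with n hn
  have hn' : (0:ℝ) < n := by exact_mod_cast hn
  have hbn := hb n
  have hhn := hh n
  simp only [Finset.mul_sum, ← Finset.sum_add_distrib]
  apply Finset.sum_congr rfl
  intro j _
  simp only [S, p]
  field_simp
  ring
end
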